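/- (Theorem 2.2, Caffarelli–Gutiérrez Harnack inequality.) Assume λ ≤ det D²u ≤ Λ in Ω. Then there exist constants τ ∈ (0, 1) and C > 0 depending only on n, λ, Λ such that for every section S_u(x, t) ⊂⊂ Ω and every nonnegative C² function v on S_u(x, t) satisfying ∑_{i,j} U^{ij} ∂_{ij} v = 0 in S_u(x, t), one has sup_{S_u(x, τt)} v ≤ C · inf_{S_u(x, τt)} v. -/

import Mathlib

open MeasureTheory

noncomputable section

/-- Euclidean space `ℝⁿ`. -/
abbrev E (n : ℕ) := EuclideanSpace ℝ (Fin n)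

/-- First partial derivative `∂_i f (x)`. -/
noncomputable def pd {n : ℕ} (f : E n → ℝ) (x : E n) (i : Fin n) : ℝ :=
  fderiv ℝ f x (EuclideanSpace.single i 1)

/-- Second partial derivative `∂_{ij} f (x)`. -/
noncomputable def pd2 {n : ℕ} (f : E n → ℝ) (x : E n) (i j : Fin n) : ℝ :=
  fderiv ℝ (fun y => fderiv ℝ f y (EuclideanSpace.single j 1)) x (EuclideanSpace.single i 1)

/-- Hessian matrix `D²f(x)`. -/
noncomputable def Hess {n : ℕ} (f : E n → ℝ) (x : E n) : Matrix (Fin n) (Fin n) ℝ :=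
  Matrix.of fun i j => pd2 f x i j

/-- The cofactor matrix `U = (det D²u)(D²u)⁻¹` of the Hessian of `u`,
realized as the adjugate. -/
noncomputable def cofU {n : ℕ} (u : E n → ℝ) (x : E n) : Matrix (Fin n) (Fin n) ℝ :=
  (Hess u x).adjugate

/-- Section of the convex function `u`:
`S_u(x₀,t) = {x ∈ cl Ω : u x < u x₀ + ∇u(x₀)·(x - x₀) + t}`. -/
def MASection {n : ℕ} (Ω : Set (E n)) (u : E n → ℝ) (x₀ : E n) (t : ℝ) : Set (E n) :=
  {x ∈ closure Ω | u x < u x₀ + fderiv ℝ u x₀ (x - x₀) + t}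

/-- `A ⊂⊂ B`: the closure of `A` is a compact subset of `B`. -/
def CptIn {n : ℕ} (A B : Set (E n)) : Prop :=
  IsCompact (closure A) ∧ closure A ⊆ B

/-- Uniform convexity of a domain: balls of radius proportional to `‖x - y‖²`
centered at midpoints of points of the closure stay in the closure. -/
def UnifConvex {n : ℕ} (Ω : Set (E n)) : Prop :=
  ∃ δ > 0, ∀ x ∈ closure Ω, ∀ y ∈ closure Ω,
    Metric.closedBall (midpoint ℝ x y) (δ * ‖x - y‖ ^ 2) ⊆ closure Ω

/-- Standing assumptions: `Ω` is a bounded, open, nonempty, uniformly convex domain and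
`u` is a smooth convex function on `cl Ω` vanishing on `∂Ω`. -/
def MASetup {n : ℕ} (Ω : Set (E n)) (u : E n → ℝ) : Prop :=
  IsOpen Ω ∧ Bornology.IsBounded Ω ∧ Ω.Nonempty ∧ UnifConvex Ω ∧
  ContDiffOn ℝ (⊤ : ℕ∞) u (closure Ω) ∧ ConvexOn ℝ (closure Ω) u ∧
  ∀ x ∈ frontier Ω, u x = 0

/-- `λ ≤ det D²u ≤ Λ` in `Ω`. -/
def DetBounds {n : ℕ} (Ω : Set (E n)) (u : E n → ℝ) (lam Lam : ℝ) : Prop :=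
  ∀ x ∈ Ω, lam ≤ (Hess u x).det ∧ (Hess u x).det ≤ Lam

/-- The Monge-Ampère measure of `u`: `μ(A) = ∫_A det D²u`. -/
noncomputable def maMeasure {n : ℕ} (u : E n → ℝ) (A : Set (E n)) : ℝ :=
  ∫ x in A, (Hess u x).det

/-- Center of mass of a set. -/
noncomputable def centerOfMass {n : ℕ} (S : Set (E n)) : E n :=
  (volume S).toReal⁻¹ • ∫ x in S, x

/-- The `α`-dilation of `S` with respect to its center of mass. -/
def dilateCM {n : ℕ} (α : ℝ) (S : Set (E n)) : Set (E n) :=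
  (fun x => centerOfMass S + α • (x - centerOfMass S)) '' S

/-- The Monge-Ampère measure of `u` is doubling with respect to the center of mass
on the sections of `u`, with constants `0 < α < 1 < β`. -/
def DoublingCM {n : ℕ} (Ω : Set (E n)) (u : E n → ℝ) (α β : ℝ) : Prop :=
  0 < α ∧ α < 1 ∧ 1 < β ∧
  ∀ x₀ ∈ Ω, ∀ t : ℝ, 0 < t → CptIn (MASection Ω u x₀ t) Ω →
    maMeasure u (MASection Ω u x₀ t) ≤ β * maMeasure u (dilateCM α (MASection Ω u x₀ (t / 2)))

/-- `g` is a Green's function of the linearized Monge-Ampère operator `L_u` in `V`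
with pole `y`: positive and smooth on `V \ {y}`, `L_u`-harmonic there, vanishing
continuously on `∂V`, and `∫_V g · (L_u φ) = φ(y)` (i.e. `∫_V g · U^{ij}∂_{ij}φ = -φ(y)`)
for all test functions `φ`. -/
def IsGreen {n : ℕ} (u : E n → ℝ) (V : Set (E n)) (y : E n) (g : E n → ℝ) : Prop :=
  (∀ x ∈ V \ {y}, 0 < g x) ∧
  ContDiffOn ℝ (⊤ : ℕ∞) g (V \ {y}) ∧
  (∀ x ∈ V \ {y}, ∑ i, ∑ j, cofU u x i j * pd2 g x i j = 0) ∧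
  ContinuousOn g (closure V \ {y}) ∧
  (∀ x ∈ frontier V, g x = 0) ∧
  ∀ φ : E n → ℝ, ContDiff ℝ (⊤ : ℕ∞) φ → HasCompactSupport φ → tsupport φ ⊆ V →
    (∫ x in V, g x * ∑ i, ∑ j, cofU u x i j * pd2 φ x i j) = -φ y

/-- Capacity of a compact set `K` relative to `V` for the operator `L_u`:
the infimum of `∫_V U^{ij} ∂_iΦ ∂_jΦ` over Lipschitz `Φ` compactly supported in `V`
with `Φ ≥ 1` on `K`. -/
noncomputable def capacity {n : ℕ} (u : E n → ℝ) (K V : Set (E n)) : ℝ :=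
  sInf { e : ℝ | ∃ Φ : E n → ℝ, (∃ L : NNReal, LipschitzWith L Φ) ∧
    HasCompactSupport Φ ∧ tsupport Φ ⊆ V ∧ (∀ x ∈ K, 1 ≤ Φ x) ∧
    e = ∫ x in V, ∑ i, ∑ j, cofU u x i j * pd Φ x i * pd Φ x j }

namespace LinMA

open Set Filter Topology

/-- Second derivative of `f` at `x` as a continuous bilinear form. -/
def D2 {n : ℕ} (f : E n → ℝ) (x : E n) : E n →L[ℝ] E n →L[ℝ] ℝ :=
  fderiv ℝ (fderiv ℝ f) x

/-- The gradient of `f` in coordinates. -/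
def grad {n : ℕ} (f : E n → ℝ) (x : E n) : E n :=
  WithLp.toLp 2 fun j => fderiv ℝ f x (EuclideanSpace.single j 1)

variable {n : ℕ}

lemma sum_smul_single (h : E n) : ∑ i, h i • EuclideanSpace.single i (1 : ℝ) = h := by
  ext j
  simp [Finset.sum_apply, Pi.single_apply]

lemma inner_grad (f : E n → ℝ) (x h : E n) : inner ℝ (grad f x) h = fderiv ℝ f x h := by
  conv_rhs => rw [← sum_smul_single h]
  simp [grad, PiLp.inner_apply]

lemma differentiableAt_fderiv {f : E n → ℝ} {x : E n} (hf : ContDiffAt ℝ 2 f x) :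
    DifferentiableAt ℝ (fderiv ℝ f) x :=
  (hf.fderiv_right (m := 1) (by norm_num)).differentiableAt (by norm_num)

lemma pd2_eq {f : E n → ℝ} {x : E n} (hf : ContDiffAt ℝ 2 f x) (i j : Fin n) :
    pd2 f x i j = D2 f x (EuclideanSpace.single i 1) (EuclideanSpace.single j 1) := by
  unfold pd2 D2
  rw [fderiv_clm_apply (differentiableAt_fderiv hf) (differentiableAt_const _)]
  simp

lemma D2_symm {f : E n → ℝ} {x : E n} (hf : ContDiffAt ℝ 2 f x) (h k : E n) :
    D2 f x h k = D2 f x k h :=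
  (hf.isSymmSndFDerivAt (by simp)).eq h k

lemma Hess_isSymm {f : E n → ℝ} {x : E n} (hf : ContDiffAt ℝ 2 f x) :
    (Hess f x).transpose = Hess f x := by
  ext i j
  simp [Hess, pd2_eq hf, D2_symm hf (EuclideanSpace.single i 1)]

lemma D2_eq_sum {f : E n → ℝ} {x : E n} (hf : ContDiffAt ℝ 2 f x) (h k : E n) :
    D2 f x h k = ∑ i, ∑ j, h i * k j * pd2 f x i j := by
  conv_lhs => rw [← sum_smul_single h, ← sum_smul_single k]
  simp only [map_sum, map_smul, sum_apply, smul_apply,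
    smul_eq_mul, pd2_eq hf, Finset.mul_sum]
  rw [Finset.sum_comm]
  refine Finset.sum_congr rfl fun i _ => Finset.sum_congr rfl fun j _ => by ring

lemma hasFDerivAt_grad {f : E n → ℝ} {x : E n} (hf : ContDiffAt ℝ 2 f x) :
    HasFDerivAt (grad f) (Matrix.toEuclideanCLM (𝕜 := ℝ) (Hess f x)) x := by
  rw [← hasFDerivWithinAt_univ, hasFDerivWithinAt_euclidean]
  intro i
  rw [hasFDerivWithinAt_univ]
  have h1 : HasFDerivAt (fun y => fderiv ℝ f y (EuclideanSpace.single i 1))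
      ((D2 f x).flip (EuclideanSpace.single i 1)) x := by
    have := (differentiableAt_fderiv hf).hasFDerivAt.clm_apply
      (hasFDerivAt_const (EuclideanSpace.single i (1 : ℝ)) x)
    refine this.congr_fderiv ?_
    ext h
    simp [D2]
  refine h1.congr_fderiv ?_
  ext h
  symm
  simp only [ContinuousLinearMap.comp_apply, ContinuousLinearMap.flip_apply]
  rw [D2_symm hf, D2_eq_sum hf]
  simp [Matrix.mulVec, dotProduct, Hess, mul_comm]

lemma det_toEuclideanCLM (A : Matrix (Fin n) (Fin n) ℝ) :
    (Matrix.toEuclideanCLM (𝕜 := ℝ) A).det = A.det := by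
  have : ((Matrix.toEuclideanCLM (𝕜 := ℝ) A : E n →L[ℝ] E n) : E n →ₗ[ℝ] E n)
      = Matrix.toLin (EuclideanSpace.basisFun (Fin n) ℝ).toBasis
        (EuclideanSpace.basisFun (Fin n) ℝ).toBasis A := by
    rfl
  rw [ContinuousLinearMap.det, this, LinearMap.det_toLin]

lemma hasDerivAt_line {f : E n → ℝ} {z h : E n} {s : ℝ} (hf : DifferentiableAt ℝ f (z + s • h)) :
    HasDerivAt (fun s : ℝ => f (z + s • h)) (fderiv ℝ f (z + s • h) h) s := by
  have h1 : HasDerivAt (fun s : ℝ => z + s • h) h s := by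
    simpa using ((hasDerivAt_id s).smul_const h).const_add z
  exact hf.hasFDerivAt.comp_hasDerivAt s h1

lemma hasDerivAt_fderiv_line {f : E n → ℝ} {z h k : E n} {s : ℝ}
    (hf : ContDiffAt ℝ 2 f (z + s • h)) :
    HasDerivAt (fun s : ℝ => fderiv ℝ f (z + s • h) k) (D2 f (z + s • h) h k) s := by
  have h1 : HasDerivAt (fun s : ℝ => z + s • h) h s := by
    simpa using ((hasDerivAt_id s).smul_const h).const_add z
  have h2 := (differentiableAt_fderiv hf).hasFDerivAt.comp_hasDerivAt s h1
  have h3 := h2.clm_apply (hasDerivAt_const s k)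
  simpa [D2] using h3

lemma D2_nonneg_of_isLocalMin {f : E n → ℝ} {z : E n} (hf : ContDiffAt ℝ 2 f z)
    (hm : IsLocalMin f z) (h : E n) : 0 ≤ D2 f z h h := by
  by_contra! hneg
  set g : ℝ → ℝ := fun s => f (z + s • h) with hg
  have hcont : Tendsto (fun s : ℝ => z + s • h) (𝓝 0) (𝓝 z) := by
    have : Continuous (fun s : ℝ => z + s • h) := by fun_prop
    simpa using this.tendsto 0
  have hev : ∀ᶠ s in 𝓝 (0 : ℝ), ContDiffAt ℝ 2 f (z + s • h) :=
    hcont.eventually (hf.eventually (by simp))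
  have hd : ∀ᶠ s in 𝓝 (0 : ℝ), deriv g s = fderiv ℝ f (z + s • h) h := by
    filter_upwards [hev] with s hs
    exact (hasDerivAt_line (hs.differentiableAt (by norm_num))).deriv
  have hdd : deriv (deriv g) 0 = D2 f z h h := by
    rw [Filter.EventuallyEq.deriv_eq hd]
    have := (hasDerivAt_fderiv_line (f := f) (z := z) (h := h) (k := h) (s := 0)
      (by simpa using hf)).deriv
    simpa using this
  have hmin : IsLocalMin g 0 := by
    have := hcont.eventually hm
    simpa [IsLocalMin, IsMinFilter, hg] using this
  have hd0 : deriv g 0 = 0 := hmin.deriv_eq_zero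
  have hgc : ContinuousAt g 0 := by
    have := hev.self_of_nhds
    exact (hasDerivAt_line (this.differentiableAt (by norm_num))).continuousAt
  have hmax := isLocalMax_of_deriv_deriv_neg (by rw [hdd]; exact hneg) hd0 hgc
  have hconst : g =ᶠ[𝓝 0] fun _ => g 0 := by
    filter_upwards [hmin, hmax] with s h1 h2 using le_antisymm h2 h1
  have h3 : deriv g =ᶠ[𝓝 0] fun _ => 0 := by
    have := hconst.deriv
    simpa using this
  have h4 : deriv (deriv g) 0 = 0 := by
    rw [h3.deriv_eq]; simp
  linarith [hdd.symm.trans h4]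

end LinMA

namespace LinMA

open Set Filter Topology Matrix

variable {n : ℕ}

lemma det_le_of_trace_le {N : Matrix (Fin n) (Fin n) ℝ} (hn : 0 < n) (hN : N.PosSemidef)
    {c : ℝ} (h : N.trace ≤ c * n) : N.det ≤ c ^ n := by
  have hn' : (0 : ℝ) < n := by exact_mod_cast hn
  rw [hN.1.det_eq_prod_eigenvalues]
  have htr : N.trace = ∑ i, hN.1.eigenvalues i := by
    simpa using hN.1.trace_eq_sum_eigenvalues
  have hnn : ∀ i ∈ (Finset.univ : Finset (Fin n)), 0 ≤ hN.1.eigenvalues i :=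
    fun i _ => hN.eigenvalues_nonneg i
  have key := Real.geom_mean_le_arith_mean Finset.univ (fun _ : Fin n => (1 : ℝ))
    hN.1.eigenvalues (fun _ _ => zero_le_one) (by simpa using hn) hnn
  simp only [Real.rpow_one, Finset.sum_const, Finset.card_univ, Fintype.card_fin, nsmul_eq_mul,
    mul_one, one_mul, ← htr] at key
  have h1 : (∏ i, hN.1.eigenvalues i) ^ ((n : ℝ)⁻¹) ≤ c :=
    key.trans (by rw [div_le_iff₀ hn']; exact h)
  have hp : 0 ≤ ∏ i, hN.1.eigenvalues i := Finset.prod_nonneg hnn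
  calc (∏ i, ((hN.1.eigenvalues i : ℝ) : ℝ))
      = ((∏ i, hN.1.eigenvalues i) ^ ((n : ℝ)⁻¹)) ^ n :=
        (Real.rpow_inv_natCast_pow hp hn.ne').symm
    _ ≤ c ^ n := pow_le_pow_left₀ (Real.rpow_nonneg hp _) h1 n

lemma exists_transpose_mul_self {M : Matrix (Fin n) (Fin n) ℝ} (hM : M.PosSemidef) :
    ∃ B : Matrix (Fin n) (Fin n) ℝ, M = Bᵀ * B := by
  open scoped MatrixOrder in
  obtain ⟨B, hB⟩ := CStarAlgebra.nonneg_iff_eq_star_mul_self.mp hM.nonneg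
  exact ⟨B, by simpa [star_eq_conjTranspose] using hB⟩

lemma adjugate_sum_eq_trace (M N : Matrix (Fin n) (Fin n) ℝ) (hN : Nᵀ = N) :
    ∑ i, ∑ j, M.adjugate i j * N i j = (M.adjugate * N).trace := by
  simp only [trace, diag, mul_apply]
  refine Finset.sum_congr rfl fun i _ => Finset.sum_congr rfl fun j _ => ?_
  rw [← hN, transpose_apply, hN]

lemma det_le_of_adjugate_trace_le {M N : Matrix (Fin n) (Fin n) ℝ} (hn : 0 < n)
    (hM : M.PosSemidef) (hdet : 0 < M.det) (hN : N.PosSemidef) {c : ℝ}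
    (h : ∑ i, ∑ j, M.adjugate i j * N i j ≤ c * n * M.det) : N.det ≤ c ^ n * M.det := by
  have hNt : Nᵀ = N := by
    have h1 := hN.1
    rwa [IsHermitian, conjTranspose_eq_transpose_of_trivial] at h1
  rw [adjugate_sum_eq_trace M N hNt] at h
  obtain ⟨B, rfl⟩ := exists_transpose_mul_self hM
  have hd : (Bᵀ * B).det = B.det ^ 2 := by rw [det_mul, det_transpose, sq]
  rw [hd] at h hdet ⊢
  have hP : ((B.adjugate)ᵀ * N * B.adjugate).PosSemidef := by
    simpa using hN.conjTranspose_mul_mul_same B.adjugate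
  have htr : ((B.adjugate)ᵀ * N * B.adjugate).trace ≤ (c * B.det ^ 2) * n := by
    rw [trace_mul_comm, ← mul_assoc, adjugate_transpose, ← adjugate_mul_distrib]
    linarith
  have hle := det_le_of_trace_le hn hP htr
  rw [det_mul, det_mul, det_transpose, det_adjugate, Fintype.card_fin] at hle
  have h3 : N.det * (B.det ^ 2) ^ (n - 1) ≤ (c ^ n * B.det ^ 2) * (B.det ^ 2) ^ (n - 1) := by
    calc N.det * (B.det ^ 2) ^ (n - 1) = B.det ^ (n - 1) * N.det * B.det ^ (n - 1) := by ring
      _ ≤ (c * B.det ^ 2) ^ n := hle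
      _ = (c ^ n * B.det ^ 2) * (B.det ^ 2) ^ (n - 1) := by
        rw [mul_pow, mul_assoc, ← pow_succ', Nat.sub_add_cancel hn]
  exact le_of_mul_le_mul_right h3 (pow_pos hdet _)

lemma sq_dotProduct_mul_det_le {M : Matrix (Fin n) (Fin n) ℝ} (hM : M.PosSemidef)
    (ξ h : Fin n → ℝ) :
    (ξ ⬝ᵥ h) ^ 2 * M.det ≤ (∑ i, ∑ j, M.adjugate i j * (ξ i * ξ j)) * (h ⬝ᵥ M *ᵥ h) := by
  obtain ⟨B, rfl⟩ := exists_transpose_mul_self hM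
  have h1 : ∑ i, ∑ j, (Bᵀ * B).adjugate i j * (ξ i * ξ j)
      = (ξ ᵥ* B.adjugate) ⬝ᵥ (ξ ᵥ* B.adjugate) := by
    have : (ξ ᵥ* B.adjugate) ⬝ᵥ (ξ ᵥ* B.adjugate) = ξ ⬝ᵥ (Bᵀ * B).adjugate *ᵥ ξ := by
      rw [adjugate_mul_distrib, ← adjugate_transpose, ← mulVec_mulVec, dotProduct_mulVec,
        mulVec_transpose]
    rw [this]
    simp only [dotProduct, mulVec, Finset.mul_sum]
    refine Finset.sum_congr rfl fun i _ => Finset.sum_congr rfl fun j _ => by ring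
  have h2 : h ⬝ᵥ (Bᵀ * B) *ᵥ h = (B *ᵥ h) ⬝ᵥ (B *ᵥ h) := by
    rw [← mulVec_mulVec, dotProduct_mulVec, vecMul_transpose]
  have h3 : (ξ ᵥ* B.adjugate) ⬝ᵥ (B *ᵥ h) = B.det * (ξ ⬝ᵥ h) := by
    rw [← dotProduct_mulVec, mulVec_mulVec, adjugate_mul, smul_mulVec, one_mulVec,
      dotProduct_smul, smul_eq_mul]
  have h4 := Finset.sum_mul_sq_le_sq_mul_sq Finset.univ (ξ ᵥ* B.adjugate) (B *ᵥ h)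
  rw [h1, h2, det_mul, det_transpose]
  have h5 : (B.det * (ξ ⬝ᵥ h)) ^ 2
      ≤ ((ξ ᵥ* B.adjugate) ⬝ᵥ (ξ ᵥ* B.adjugate)) * ((B *ᵥ h) ⬝ᵥ (B *ᵥ h)) := by
    rw [← h3]
    simpa [dotProduct, sq] using h4
  linarith [h5]

end LinMA

namespace LinMA

open Set Filter Topology

variable {n : ℕ}

/-- The difference of `u` and its tangent plane at `x`. -/
def bd (u : E n → ℝ) (x y : E n) : ℝ := u y - u x - fderiv ℝ u x (y - x)

/-- The properties of `Ω` and `u` that the local theory uses. -/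
structure MAData (Ω : Set (E n)) (u : E n → ℝ) (lam Lam : ℝ) : Prop where
  isOpen : IsOpen Ω
  smooth : ∀ x ∈ Ω, ContDiffAt ℝ 2 u x
  conv : ConvexOn ℝ (closure Ω) u
  cont : ContinuousOn u (closure Ω)
  lam_pos : 0 < lam
  lb : ∀ x ∈ Ω, lam ≤ (Hess u x).det
  ub : ∀ x ∈ Ω, (Hess u x).det ≤ Lam

/-- The section at `x` of height `t` is compactly contained in `Ω`. -/
structure Adm (Ω : Set (E n)) (u : E n → ℝ) (x : E n) (t : ℝ) : Prop where
  mem : x ∈ Ω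
  pos : 0 < t
  cpt : CptIn (MASection Ω u x t) Ω

variable {Ω : Set (E n)} {u : E n → ℝ} {lam Lam : ℝ} {x y z : E n} {s t : ℝ}

lemma MAData.of_setup (h : MASetup Ω u) (hd : DetBounds Ω u lam Lam) (hl : 0 < lam) :
    MAData Ω u lam Lam where
  isOpen := h.1
  smooth x hx := by
    have h1 : ContDiffAt ℝ (⊤ : ℕ∞) u x := h.2.2.2.2.1.contDiffAt
      (mem_of_superset (h.1.mem_nhds hx) subset_closure)
    exact h1.of_le (WithTop.coe_le_coe.mpr (le_top : (2 : ℕ∞) ≤ ⊤))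
  conv := h.2.2.2.2.2.1
  cont := h.2.2.2.2.1.continuousOn
  lam_pos := hl
  lb x hx := (hd x hx).1
  ub x hx := (hd x hx).2

lemma mem_section : y ∈ MASection Ω u x t ↔ y ∈ closure Ω ∧ bd u x y < t := by
  simp only [MASection, bd, mem_ofPred_eq]
  exact and_congr_right fun _ => ⟨fun h => by linarith, fun h => by linarith⟩

lemma bd_self : bd u x x = 0 := by simp [bd]

lemma bd_add_bd : bd u x y + bd u y x = (fderiv ℝ u y - fderiv ℝ u x) (y - x) := by
  have : fderiv ℝ u y (x - y) = - fderiv ℝ u y (y - x) := by rw [← map_neg, neg_sub]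
  simp only [bd, sub_apply, this]
  ring

lemma bd_eq_of (w : E n) : bd u w z = bd u x z - bd u x w
    - (fderiv ℝ u w - fderiv ℝ u x) (z - w) := by
  have : fderiv ℝ u x (z - x) = fderiv ℝ u x (z - w) + fderiv ℝ u x (w - x) := by
    rw [← map_add]; congr 1; abel
  simp only [bd, sub_apply, this]
  ring

section local_min

variable {f : E n → ℝ} {L : E n →L[ℝ] ℝ}

lemma fderiv_eq_of_isLocalMin_sub (hf : ContDiffAt ℝ 2 f z)
    (hm : IsLocalMin (fun y => f y - L y) z) : fderiv ℝ f z = L := by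
  have h1 := (hf.differentiableAt (by norm_num)).hasFDerivAt.sub L.hasFDerivAt
  exact sub_eq_zero.mp (hm.hasFDerivAt_eq_zero h1)

lemma D2_sub_clm (hf : ContDiffAt ℝ 2 f z) (L : E n →L[ℝ] ℝ) :
    D2 (fun y => f y - L y) z = D2 f z := by
  unfold D2
  have h1 : fderiv ℝ (fun y => f y - L y) =ᶠ[𝓝 z] fun y => fderiv ℝ f y - L := by
    filter_upwards [hf.eventually (by simp)] with y hy
    exact ((hy.differentiableAt (by norm_num)).hasFDerivAt.sub L.hasFDerivAt).fderiv
  rw [h1.fderiv_eq, fderiv_sub_const]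

lemma D2_nonneg_of_isLocalMin_sub (hf : ContDiffAt ℝ 2 f z)
    (hm : IsLocalMin (fun y => f y - L y) z) (h : E n) : 0 ≤ D2 f z h h := by
  rw [← D2_sub_clm hf L]
  exact D2_nonneg_of_isLocalMin (hf.sub L.contDiff.contDiffAt) hm h

lemma Hess_posSemidef_of_D2_nonneg (hf : ContDiffAt ℝ 2 f z) (h : ∀ h, 0 ≤ D2 f z h h) :
    (Hess f z).PosSemidef := by
  refine Matrix.PosSemidef.of_dotProduct_mulVec_nonneg ?_ fun v => ?_
  · rw [Matrix.IsHermitian, Matrix.conjTranspose_eq_transpose_of_trivial, Hess_isSymm hf]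
  · have := h (WithLp.toLp 2 v)
    rw [D2_eq_sum hf] at this
    simpa [dotProduct, Matrix.mulVec, Hess, Finset.mul_sum, mul_assoc, mul_comm,
      mul_left_comm] using this

lemma D2_eq_dotProduct (hf : ContDiffAt ℝ 2 f z) (h : E n) :
    D2 f z h h = dotProduct h.ofLp (Matrix.mulVec (Hess f z) h.ofLp) := by
  rw [D2_eq_sum hf]
  simp [dotProduct, Matrix.mulVec, Hess, Finset.mul_sum, mul_comm, mul_left_comm]

end local_min

namespace MAData

variable (H : MAData Ω u lam Lam)
include H

lemma differentiableAt (hx : x ∈ Ω) : DifferentiableAt ℝ u x :=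
  (H.smooth x hx).differentiableAt (by norm_num)

lemma bd_convexOn (x : E n) : ConvexOn ℝ (closure Ω) (bd u x) := by
  have h1 : ConvexOn ℝ (closure Ω) (fun y => (-(fderiv ℝ u x)) y) :=
    (-(fderiv ℝ u x)).toLinearMap.convexOn H.conv.1
  have h2 := (H.conv.add h1).add_const (- u x + fderiv ℝ u x x)
  refine h2.congr fun y _ => ?_
  simp [bd, map_sub]; ring

lemma bd_continuousOn (x : E n) : ContinuousOn (bd u x) (closure Ω) := by
  unfold bd
  have := H.cont
  fun_prop

lemma bd_nonneg (hx : x ∈ Ω) (hy : y ∈ closure Ω) : 0 ≤ bd u x y := by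
  have h1 := H.conv.comp_affineMap (AffineMap.lineMap x y)
  have h2 : HasDerivAt (fun s : ℝ => u (x + s • (y - x))) (fderiv ℝ u x (y - x)) 0 := by
    have := hasDerivAt_line (f := u) (z := x) (h := y - x) (s := 0)
      (by simpa using H.differentiableAt hx)
    simpa using this
  have h3 : (u ∘ (AffineMap.lineMap x y : ℝ →ᵃ[ℝ] E n)) = fun s : ℝ => u (x + s • (y - x)) := by
    ext s; simp [AffineMap.lineMap_apply_module', add_comm]
  rw [h3] at h1
  have h4 := h1.le_slope_of_hasDerivAt (x := 0) (y := 1) (by simpa using subset_closure hx)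
    (by simpa using hy) one_pos h2
  simp [slope_def_field] at h4
  simp [bd]; linarith

lemma D2_nonneg (hx : x ∈ Ω) (h : E n) : 0 ≤ D2 u x h h := by
  refine D2_nonneg_of_isLocalMin_sub (H.smooth x hx) (L := fderiv ℝ u x) ?_ h
  filter_upwards [H.isOpen.mem_nhds hx] with y hy
  have := H.bd_nonneg hx (subset_closure hy)
  simp only [bd, map_sub] at this
  linarith

lemma posSemidef (hx : x ∈ Ω) : (Hess u x).PosSemidef :=
  Hess_posSemidef_of_D2_nonneg (H.smooth x hx) (H.D2_nonneg hx)

lemma det_pos (hx : x ∈ Ω) : 0 < (Hess u x).det := H.lam_pos.trans_le (H.lb x hx)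

lemma Lam_pos (hx : x ∈ Ω) : 0 < Lam := (H.det_pos hx).trans_le (H.ub x hx)

lemma D2_pos (hx : x ∈ Ω) {h : E n} (hh : h ≠ 0) : 0 < D2 u x h h := by
  have h1 := ((H.posSemidef hx).posDef_iff_det_ne_zero).mpr (H.det_pos hx).ne'
  rw [D2_eq_dotProduct (H.smooth x hx)]
  have := h1.dotProduct_mulVec_pos (x := h.ofLp) (by simpa using hh)
  simpa using this

lemma bd_line_le (hy : y ∈ closure Ω) (hz : z ∈ closure Ω) (h0 : 0 ≤ s) (h1 : s ≤ 1) (x : E n) :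
    bd u x (y + s • (z - y)) ≤ (1 - s) * bd u x y + s * bd u x z := by
  have := (H.bd_convexOn x).2 hy hz (sub_nonneg.mpr h1) h0 (by ring)
  have h2 : (1 - s) • y + s • z = y + s • (z - y) := by
    rw [sub_smul, one_smul, smul_sub]; abel
  rw [h2] at this
  simpa using this

lemma line_mem (hy : y ∈ closure Ω) (hz : z ∈ closure Ω) (h0 : 0 ≤ s) (h1 : s ≤ 1) :
    y + s • (z - y) ∈ closure Ω := H.conv.1.add_smul_sub_mem hy hz ⟨h0, h1⟩

lemma mem_closure_section (hx : x ∈ Ω) (ht : 0 < t) (hz : z ∈ closure Ω) (hzt : bd u x z ≤ t) :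
    z ∈ closure (MASection Ω u x t) := by
  have hc : Continuous (fun s : ℝ => x + s • (z - x)) := by fun_prop
  have h1 : Tendsto (fun s : ℝ => x + s • (z - x)) (𝓝[<] 1) (𝓝 z) := by
    have := hc.tendsto 1
    simp only [one_smul, add_sub_cancel] at this
    exact this.mono_left nhdsWithin_le_nhds
  refine mem_closure_of_tendsto h1 ?_
  filter_upwards [Ioo_mem_nhdsLT (zero_lt_one' ℝ)] with s hs
  rw [mem_section]
  refine ⟨H.line_mem (subset_closure hx) hz hs.1.le hs.2.le, ?_⟩
  have := H.bd_line_le (subset_closure hx) hz hs.1.le hs.2.le x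
  rw [bd_self] at this
  nlinarith [hs.1, hs.2, mul_le_mul_of_nonneg_left hzt hs.1.le]

lemma section_convex (x : E n) (t : ℝ) : Convex ℝ (MASection Ω u x t) := by
  have := (H.bd_convexOn x).convex_lt t
  have h : MASection Ω u x t = {y ∈ closure Ω | bd u x y < t} := Set.ext fun y => mem_section
  rwa [h]

/-- On a convex subset of `Ω` the gradient of `u` is injective. -/
lemma grad_injOn {K : Set (E n)} (hK : Convex ℝ K) (hKΩ : K ⊆ Ω) : InjOn (grad u) K := by
  intro a ha b hb hab
  by_contra hne
  have hseg : ∀ s ∈ Icc (0 : ℝ) 1, a + s • (b - a) ∈ Ω := fun s hs =>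
    hKΩ (hK.add_smul_sub_mem ha hb hs)
  have hd : ∀ s ∈ Icc (0 : ℝ) 1, HasDerivAt (fun s : ℝ => fderiv ℝ u (a + s • (b - a)) (b - a))
      (D2 u (a + s • (b - a)) (b - a) (b - a)) s := fun s hs =>
    hasDerivAt_fderiv_line (H.smooth _ (hseg s hs))
  have hmono : StrictMonoOn (fun s : ℝ => fderiv ℝ u (a + s • (b - a)) (b - a)) (Icc 0 1) := by
    refine strictMonoOn_of_deriv_pos (convex_Icc 0 1)
      (fun s hs => (hd s hs).continuousAt.continuousWithinAt) fun s hs => ?_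
    rw [interior_Icc] at hs
    have hs' := Ioo_subset_Icc_self hs
    rw [(hd s hs').deriv]
    exact H.D2_pos (hseg s hs') (sub_ne_zero.mpr (Ne.symm hne))
  have := hmono (left_mem_Icc.mpr zero_le_one) (right_mem_Icc.mpr zero_le_one) one_pos
  simp only [zero_smul, add_zero, one_smul, add_sub_cancel, ← inner_grad, hab] at this
  exact lt_irrefl _ this

end MAData

namespace Adm

variable (A : Adm Ω u x t)
include A

lemma subset : MASection Ω u x t ⊆ Ω := subset_closure.trans A.cpt.2

lemma self_mem : x ∈ MASection Ω u x t :=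
  mem_section.mpr ⟨subset_closure A.mem, by rw [bd_self]; exact A.pos⟩

lemma of_subset (hy : y ∈ Ω) (hs : 0 < s) (h : MASection Ω u y s ⊆ MASection Ω u x t) :
    Adm Ω u y s where
  mem := hy
  pos := hs
  cpt := ⟨A.cpt.1.of_isClosed_subset isClosed_closure (closure_mono h),
    (closure_mono h).trans A.cpt.2⟩

omit A in
lemma _root_.LinMA.section_mono (hst : s ≤ t) : MASection Ω u x s ⊆ MASection Ω u x t := by
  intro y hy
  rw [mem_section] at hy ⊢
  exact ⟨hy.1, hy.2.trans_le hst⟩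

lemma mono (hs : 0 < s) (hst : s ≤ t) : Adm Ω u x s :=
  A.of_subset A.mem hs (section_mono hst)

variable (H : MAData Ω u lam Lam)
include H

lemma isOpen : IsOpen (MASection Ω u x t) := by
  have h : MASection Ω u x t = Ω ∩ bd u x ⁻¹' Iio t := by
    ext y
    constructor
    · intro hy; exact ⟨A.subset hy, (mem_section.mp hy).2⟩
    · intro hy; exact mem_section.mpr ⟨subset_closure hy.1, hy.2⟩
  rw [h]
  exact ((H.bd_continuousOn x).mono subset_closure).isOpen_inter_preimage H.isOpen isOpen_Iio

lemma bd_le (hz : z ∈ closure (MASection Ω u x t)) : bd u x z ≤ t := by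
  have hc : ContinuousWithinAt (bd u x) (MASection Ω u x t) z :=
    ((H.bd_continuousOn x) z (subset_closure (A.cpt.2 hz))).mono
      (A.subset.trans subset_closure)
  have := mem_closure_iff_nhdsWithin_neBot.mp hz
  refine le_of_tendsto hc ?_
  filter_upwards [self_mem_nhdsWithin] with w hw using (mem_section.mp hw).2.le

omit H in
lemma le_bd (hz : z ∈ closure (MASection Ω u x t)) (h : z ∉ MASection Ω u x t) :
    t ≤ bd u x z := by
  by_contra! hlt
  exact h (mem_section.mpr ⟨subset_closure (A.cpt.2 hz), hlt⟩)

omit A in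
lemma _root_.LinMA.MAData.closure_convex : Convex ℝ (closure (MASection Ω u x t)) :=
  (H.section_convex x t).closure

lemma closure_subset_of_lt (hst : s < t) (hs : 0 < s) :
    closure (MASection Ω u x s) ⊆ MASection Ω u x t := fun z hz => by
  have A' := A.mono hs hst.le
  exact mem_section.mpr ⟨subset_closure (A'.cpt.2 hz), (A'.bd_le H hz).trans_lt hst⟩

omit H in
lemma measurableSet (H : MAData Ω u lam Lam) : MeasurableSet (MASection Ω u x t) :=
  (A.isOpen H).measurableSet

omit H in
lemma volume_lt_top : volume (MASection Ω u x t) < ⊤ :=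
  (measure_mono subset_closure).trans_lt A.cpt.1.measure_lt_top

lemma volume_pos : 0 < volume (MASection Ω u x t) :=
  (A.isOpen H).measure_pos _ ⟨x, A.self_mem⟩

lemma volume_real_pos : 0 < volume.real (MASection Ω u x t) :=
  ENNReal.toReal_pos (A.volume_pos H).ne' A.volume_lt_top.ne

/-- A continuous function on the closed section with a value below its boundary values
attains its minimum at an interior point. -/
lemma exists_min {f : E n → ℝ} (hf : ContinuousOn f (closure (MASection Ω u x t)))
    (hy : y ∈ closure (MASection Ω u x t))
    (hb : ∀ z ∈ closure (MASection Ω u x t), z ∉ MASection Ω u x t → f y < f z) :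
    ∃ z ∈ MASection Ω u x t, IsLocalMin f z ∧
      ∀ w ∈ closure (MASection Ω u x t), f z ≤ f w := by
  obtain ⟨z, hz, hmin⟩ := A.cpt.1.exists_isMinOn ⟨y, hy⟩ hf
  have hzS : z ∈ MASection Ω u x t := by
    by_contra hzS
    exact absurd (hmin hy) (not_le.mpr (hb z hz hzS))
  exact ⟨z, hzS, hmin.isLocalMin (mem_of_superset ((A.isOpen H).mem_nhds hzS) subset_closure),
    fun w hw => hmin hw⟩

end Adm

section gradient_image

variable {f : E n → ℝ} {A : Set (E n)} {c : ℝ}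

lemma volume_grad_image_le (hA : MeasurableSet A) (hf : ∀ x ∈ A, ContDiffAt ℝ 2 f x)
    (hd : ∀ x ∈ A, |(Hess f x).det| ≤ c) :
    volume (grad f '' A) ≤ ENNReal.ofReal c * volume A := by
  refine (addHaar_image_le_lintegral_abs_det_fderiv volume hA
    (fun x hx => (hasFDerivAt_grad (hf x hx)).hasFDerivWithinAt)).trans ?_
  rw [← setLIntegral_const]
  refine setLIntegral_mono measurable_const fun x hx => ENNReal.ofReal_le_ofReal ?_
  rw [det_toEuclideanCLM]
  exact hd x hx

lemma le_volume_grad_image (hA : MeasurableSet A) (hf : ∀ x ∈ A, ContDiffAt ℝ 2 f x)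
    (hinj : InjOn (grad f) A) (hd : ∀ x ∈ A, c ≤ (Hess f x).det) :
    ENNReal.ofReal c * volume A ≤ volume (grad f '' A) := by
  rw [← lintegral_abs_det_fderiv_eq_addHaar_image volume hA
    (fun x hx => (hasFDerivAt_grad (hf x hx)).hasFDerivWithinAt) hinj, ← setLIntegral_const]
  refine setLIntegral_mono' hA fun x hx => ENNReal.ofReal_le_ofReal ?_
  rw [det_toEuclideanCLM]
  exact (hd x hx).trans (le_abs_self _)

end gradient_image

end LinMA

namespace LinMA

open Set Filter Topology

variable {n : ℕ}

local notation "toCLM" => Matrix.toEuclideanCLM (𝕜 := ℝ)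

lemma volume_box (a b : ℝ) :
    volume {c : E n | ∀ i, c i ∈ Icc a b} = ENNReal.ofReal (b - a) ^ n := by
  have h : {c : E n | ∀ i, c i ∈ Icc a b}
      = (WithLp.ofLp : E n → Fin n → ℝ) ⁻¹' (Icc (fun _ => a) (fun _ => b)) := by
    ext c
    simp only [mem_ofPred_eq, mem_preimage, mem_Icc, Pi.le_def]
    exact forall_and
  rw [h, (PiLp.volume_preserving_ofLp (Fin n)).measure_preimage
    measurableSet_Icc.nullMeasurableSet, Real.volume_Icc_pi]
  simp

lemma isCompact_box (a b : ℝ) : IsCompact {c : E n | ∀ i, c i ∈ Icc a b} := by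
  have h : {c : E n | ∀ i, c i ∈ Icc a b}
      = (PiLp.homeomorph 2 (fun _ : Fin n => ℝ)) ⁻¹' (Icc (fun _ => a) (fun _ => b)) := by
    ext c
    simp only [mem_ofPred_eq, mem_preimage, mem_Icc, Pi.le_def]
    exact forall_and
  rw [h, Homeomorph.isCompact_preimage]
  exact isCompact_Icc

lemma volume_image_frame (s0 : E n) (A : Matrix (Fin n) (Fin n) ℝ) (a b : ℝ) :
    volume ((fun c => s0 + toCLM A c) '' {c : E n | ∀ i, c i ∈ Icc a b})
      = ENNReal.ofReal |A.det| * ENNReal.ofReal (b - a) ^ n := by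
  have h : (fun c => s0 + toCLM A c) '' {c : E n | ∀ i, c i ∈ Icc a b}
      = (fun y => s0 + y) '' (toCLM A '' {c : E n | ∀ i, c i ∈ Icc a b}) := by
    rw [image_image]
  rw [h, image_add_left, measure_preimage_add, Measure.addHaar_image_continuousLinearMap,
    volume_box]
  congr 3
  exact det_toEuclideanCLM A

lemma volume_preimage_frame {A : Matrix (Fin n) (Fin n) ℝ} (hA : A.det ≠ 0) (s : Set (E n)) :
    volume (toCLM A.transpose ⁻¹' s) = ENNReal.ofReal |A.det|⁻¹ * volume s := by
  have hd : LinearMap.det ((toCLM A.transpose : E n →L[ℝ] E n) : E n →ₗ[ℝ] E n) = A.det := by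
    have := det_toEuclideanCLM A.transpose
    rwa [Matrix.det_transpose] at this
  rw [Measure.addHaar_preimage_continuousLinearMap _ (by rwa [hd]), hd, abs_inv]

lemma inner_frame (A : Matrix (Fin n) (Fin n) ℝ) (p c : E n) :
    inner ℝ p (toCLM A c) = ∑ i, (toCLM A.transpose p) i * c i := by
  simp only [PiLp.inner_apply, Matrix.ofLp_toEuclideanCLM, Matrix.mulVec, dotProduct,
    Matrix.transpose_apply, RCLike.inner_apply, conj_trivial, Finset.sum_mul]
  rw [Finset.sum_comm]
  refine Finset.sum_congr rfl fun i _ => Finset.sum_congr rfl fun j _ => by ring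

lemma inner_frame_single (A : Matrix (Fin n) (Fin n) ℝ) (p : E n) (σ : ℝ) (i : Fin n) :
    inner ℝ p (toCLM A (σ • EuclideanSpace.single i 1)) = σ * (toCLM A.transpose p) i := by
  rw [inner_frame, Finset.sum_eq_single i]
  · simp [mul_comm]
  · intro j _ hj
    simp [hj]
  · simp

lemma abs_inner_frame_le {A : Matrix (Fin n) (Fin n) ℝ} {p c : E n} {r m : ℝ}
    (hp : ∀ i, |(toCLM A.transpose p) i| ≤ r) (hc : ∀ i, |c i| ≤ m) :
    |inner ℝ p (toCLM A c)| ≤ n * (r * m) := by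
  rw [inner_frame]
  refine (Finset.abs_sum_le_sum_abs _ _).trans ?_
  calc ∑ i, |(toCLM A.transpose p) i * c i| ≤ ∑ _i : Fin n, r * m := by
        refine Finset.sum_le_sum fun i _ => ?_
        rw [abs_mul]
        exact mul_le_mul (hp i) (hc i) (abs_nonneg _) ((abs_nonneg _).trans (hp i))
    _ = n * (r * m) := by simp

/-- `K` contains a simplex with vertex `s0` and edges the columns of `A`, and is contained in the
corresponding centered parallelepiped. -/
structure IsFrame (K : Set (E n)) (s0 : E n) (A : Matrix (Fin n) (Fin n) ℝ) : Prop where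
  det_ne : A.det ≠ 0
  mem : ∀ c : E n, (∀ i, 0 ≤ c i) → ∑ i, c i ≤ 1 → s0 + toCLM A c ∈ K
  exists_coord : ∀ z ∈ K, ∃ c : E n, (∀ i, |c i| ≤ 1) ∧ z = s0 + toCLM A c

lemma exists_isFrame {K : Set (E n)} (hK : IsCompact K) (hconv : Convex ℝ K)
    (hint : (interior K).Nonempty) : ∃ s0 A, IsFrame K s0 A := by
  obtain ⟨p, hp⟩ := hint
  obtain ⟨r, hr, hball⟩ := Metric.isOpen_iff.mp isOpen_interior p hp
  have hpK := interior_subset hp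
  set M : E n × (Fin n → E n) → Matrix (Fin n) (Fin n) ℝ :=
    fun q => Matrix.of fun i j => q.2 j i - q.1 i with hM
  have hMc : Continuous fun q => |(M q).det| := by
    refine continuous_abs.comp (Continuous.matrix_det ?_)
    refine continuous_matrix fun i j => ?_
    simp only [hM, Matrix.of_apply]
    fun_prop
  have hcomp : IsCompact (K ×ˢ (Set.univ.pi fun _ : Fin n => K)) :=
    hK.prod (isCompact_univ_pi fun _ => hK)
  have hq0 : (p, fun j => p + (r / 2) • EuclideanSpace.single j (1 : ℝ))
      ∈ K ×ˢ (Set.univ.pi fun _ : Fin n => K) := by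
    refine ⟨hpK, fun j _ => interior_subset (hball ?_)⟩
    simp [norm_smul, abs_of_pos hr]
    linarith
  obtain ⟨⟨s0, s⟩, ⟨hs0, hs⟩, hmax⟩ := hcomp.exists_isMaxOn ⟨_, hq0⟩ hMc.continuousOn
  have hs0 : s0 ∈ K := hs0
  have hs : ∀ j, s j ∈ K := fun j => hs j (mem_univ j)
  set A := M (s0, s) with hA
  have hdet : A.det ≠ 0 := by
    have h1 : M (p, fun j => p + (r / 2) • EuclideanSpace.single j (1 : ℝ))
        = (r / 2) • (1 : Matrix (Fin n) (Fin n) ℝ) := by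
      ext i j
      simp [hM, Matrix.one_apply]
    have h2 := hmax hq0
    simp only [mem_ofPred_eq, h1, Matrix.det_smul, Matrix.det_one, mul_one, Fintype.card_fin] at h2
    have h3 : 0 < |(r / 2) ^ n| := abs_pos.mpr (pow_ne_zero _ (by positivity))
    exact abs_pos.mp (h3.trans_le h2)
  have hTA : ∀ c : E n, toCLM A c = ∑ j, c j • (s j - s0) := by
    intro c
    ext i
    simp [hA, hM, Matrix.mulVec, dotProduct, Finset.sum_apply, mul_comm]
  refine ⟨s0, A, hdet, fun c hc hsum => ?_, fun z hz => ?_⟩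
  · rw [hTA]
    have h1 : s0 + ∑ j, c j • (s j - s0) = (1 - ∑ j, c j) • s0 + ∑ j, c j • s j := by
      simp only [smul_sub, Finset.sum_sub_distrib, sub_smul, one_smul, Finset.sum_smul]
      abel
    rw [h1]
    have h2 := hconv.sum_mem (t := (Finset.univ : Finset (Option (Fin n))))
      (w := fun o => o.elim (1 - ∑ j, c j) c) (z := fun o => o.elim s0 s)
      (by rintro (_ | i) _ <;> simp [hc, hsum]) (by simp [Fintype.sum_option])
      (by rintro (_ | i) _ <;> simp [hs0, hs])
    simpa [Fintype.sum_option] using h2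
  · refine ⟨WithLp.toLp 2 (A⁻¹.mulVec (z - s0).ofLp), fun i => ?_, ?_⟩
    · have h1 : M (s0, Function.update s i z) = A.updateCol i (z - s0).ofLp := by
        ext k j
        rcases eq_or_ne j i with rfl | hj
        · simp [hM]
        · simp [hM, hA, Matrix.updateCol_ne hj, Function.update_of_ne hj]
      have h2 := hmax (show (s0, Function.update s i z) ∈ K ×ˢ (Set.univ.pi fun _ => K) from
        ⟨hs0, fun j _ => by
          rcases eq_or_ne j i with rfl | hj
          · simpa using hz
          · simpa [Function.update_of_ne hj] using hs j⟩)
      simp only [mem_ofPred_eq, h1] at h2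
      rw [← Matrix.cramer_apply, Matrix.cramer_eq_adjugate_mulVec] at h2
      have h3 : A.adjugate = A.det • A⁻¹ := by
        rw [Matrix.inv_def, smul_smul, Ring.mul_inverse_cancel _ (isUnit_iff_ne_zero.mpr hdet),
          one_smul]
      rw [h3, Matrix.smul_mulVec, Pi.smul_apply, smul_eq_mul, abs_mul] at h2
      exact le_of_mul_le_mul_left (by rw [mul_one]; exact h2) (abs_pos.mpr hdet)
    · ext k
      simp [Matrix.mul_nonsing_inv _ (isUnit_iff_ne_zero.mpr hdet)]

variable {Ω : Set (E n)} {u : E n → ℝ} {lam Lam : ℝ} {x y z : E n} {s t : ℝ}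

lemma MAData.slope_le (H : MAData Ω u lam Lam) (hy : y ∈ Ω) (hz : z ∈ closure Ω) (x : E n) :
    (fderiv ℝ u y - fderiv ℝ u x) (z - y) ≤ bd u x z - bd u x y := by
  have h1 := H.bd_nonneg hy hz
  rw [bd_eq_of (x := x)] at h1
  linarith

lemma inner_grad_sub (f : E n → ℝ) (x y h : E n) :
    inner ℝ (grad f y - grad f x) h = (fderiv ℝ f y - fderiv ℝ f x) h := by
  rw [inner_sub_left, inner_grad, inner_grad, sub_apply]

namespace Adm

variable (A : Adm Ω u x t) (H : MAData Ω u lam Lam)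
include A H

lemma exists_frame : ∃ s0 M, IsFrame (closure (MASection Ω u x t)) s0 M :=
  exists_isFrame A.cpt.1 H.closure_convex
    ⟨x, interior_mono subset_closure (by rw [(A.isOpen H).interior_eq]; exact A.self_mem)⟩

variable {s0 : E n} {M : Matrix (Fin n) (Fin n) ℝ}

lemma frame_det_sq_le (hn : 0 < n) (F : IsFrame (closure (MASection Ω u x t)) s0 M) :
    M.det ^ 2 ≤ (16 * n ^ 2) ^ n / lam * t ^ n := by
  have hn1 : (1 : ℝ) ≤ n := by exact_mod_cast hn
  have hn' : (0 : ℝ) < n := by linarith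
  have ht := A.pos
  set r : ℝ := 1 / (4 * n) with hr
  have hr0 : 0 < r := by positivity
  have hrn : n * r = 1 / 4 := by rw [hr]; field_simp
  have hr1 : r ≤ 1 / 4 := by nlinarith
  set Y := (fun c => s0 + toCLM M c) '' {c : E n | ∀ i, c i ∈ Icc r (3 * r)} with hY
  have hmem : ∀ c : E n, (∀ i, c i ∈ Icc r (3 * r)) → ∀ i, ∀ σ : ℝ, |σ| ≤ r →
      s0 + toCLM M (c + σ • EuclideanSpace.single i 1) ∈ closure (MASection Ω u x t) := by
    intro c hc i σ hσ
    rw [abs_le] at hσ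
    refine F.mem _ (fun j => ?_) ?_
    · have := (hc j).1
      rcases eq_or_ne j i with rfl | hj
      · simp; linarith
      · simp [hj]; linarith
    · have h1 : ∑ j, c j ≤ ∑ _j : Fin n, 3 * r := Finset.sum_le_sum fun j _ => (hc j).2
      simp only [Finset.sum_const, Finset.card_univ, Fintype.card_fin, nsmul_eq_mul] at h1
      simp [Finset.sum_add_distrib]
      nlinarith
  have hYK : Y ⊆ closure (MASection Ω u x t) := by
    rintro _ ⟨c, hc, rfl⟩
    have := hmem c hc ⟨0, hn⟩ 0 (by simpa using hr0.le)
    simpa using this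
  have hYmeas : MeasurableSet Y := by
    refine (IsCompact.image (isCompact_box _ _) ?_).isClosed.measurableSet
    fun_prop
  have h1 := le_volume_grad_image (c := lam) hYmeas (fun y hy => H.smooth y (A.cpt.2 (hYK hy)))
    ((H.grad_injOn H.closure_convex A.cpt.2).mono hYK)
    (fun y hy => H.lb y (A.cpt.2 (hYK hy)))
  have h2 : grad u '' Y ⊆ (fun p => p - grad u x) ⁻¹'
      (toCLM M.transpose ⁻¹' {c : E n | ∀ i, c i ∈ Icc (-(4 * n * t)) (4 * n * t)}) := by
    rintro _ ⟨y, hyY, rfl⟩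
    intro i
    have hyK := hYK hyY
    have hyΩ := A.cpt.2 hyK
    have h0 := H.bd_nonneg A.mem (subset_closure hyΩ)
    obtain ⟨c, hc, rfl⟩ := hyY
    have key : ∀ σ : ℝ, |σ| ≤ r →
        σ * (toCLM M.transpose (grad u (s0 + toCLM M c) - grad u x)) i ≤ t := by
      intro σ hσ
      have hz := hmem c hc i σ hσ
      have h3 := H.slope_le hyΩ (subset_closure (A.cpt.2 hz)) x
      have h4 := A.bd_le H hz
      have e : s0 + toCLM M (c + σ • EuclideanSpace.single i 1) - (s0 + toCLM M c)
          = toCLM M (σ • EuclideanSpace.single i 1) := by rw [map_add]; abel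
      rw [← inner_grad_sub, e, inner_frame_single] at h3
      linarith
    have hk1 := key r (by rw [abs_of_pos hr0])
    have hk2 := key (-r) (by rw [abs_neg, abs_of_pos hr0])
    have hrt : r * (4 * n * t) = t := by rw [hr]; field_simp
    constructor
    · refine le_of_mul_le_mul_left ?_ hr0; linarith
    · refine le_of_mul_le_mul_left ?_ hr0; linarith
  have h3 := h1.trans (measure_mono h2)
  rw [show (fun p => p - grad u x) = fun p => p + -(grad u x) from
      funext fun p => sub_eq_add_neg _ _, measure_preimage_add_right,
    volume_preimage_frame F.det_ne,
    volume_box, hY,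
    volume_image_frame, ← ENNReal.ofReal_pow (by linarith), ← ENNReal.ofReal_pow (by
      have : 0 ≤ n * t := by positivity
      linarith), ← ENNReal.ofReal_mul (by positivity), ← ENNReal.ofReal_mul H.lam_pos.le,
    ← ENNReal.ofReal_mul (by positivity)] at h3
  rw [ENNReal.ofReal_le_ofReal_iff (by
      have : 0 ≤ n * t := by positivity
      have : 0 ≤ 4 * n * t - -(4 * n * t) := by linarith
      positivity)] at h3
  have hD : 0 < |M.det| := abs_pos.mpr F.det_ne
  have e1 : 3 * r - r = 1 / (2 * n) := by rw [hr]; field_simp; norm_num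
  have e2 : 4 * n * t - -(4 * n * t) = 8 * n * t := by ring
  rw [e1, e2] at h3
  rw [← sq_abs, div_mul_eq_mul_div, le_div_iff₀ H.lam_pos]
  have e3 : (16 * (n : ℝ) ^ 2) ^ n * t ^ n = (8 * n * t) ^ n * (2 * n) ^ n := by
    rw [← mul_pow, ← mul_pow]; congr 1; ring
  rw [e3]
  have e4 : (1 / (2 * (n : ℝ))) ^ n * (2 * n) ^ n = 1 := by
    rw [← mul_pow]; rw [one_div_mul_cancel (by positivity)]; simp
  have h5 := mul_le_mul_of_nonneg_right h3 (show 0 ≤ |M.det| * (2 * (n : ℝ)) ^ n by positivity)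
  calc |M.det| ^ 2 * lam = lam * (|M.det| * (1 / (2 * (n : ℝ))) ^ n) * (|M.det| * (2 * n) ^ n) := by
        linear_combination (-(lam * |M.det| ^ 2)) * e4
    _ ≤ _ := h5
    _ = _ := by field_simp

omit A H in
lemma _root_.LinMA.volume_le_frame (F : IsFrame (closure (MASection Ω u x t)) s0 M) :
    volume (closure (MASection Ω u x t)) ≤ ENNReal.ofReal (2 ^ n * |M.det|) := by
  have h : closure (MASection Ω u x t)
      ⊆ (fun c => s0 + toCLM M c) '' {c : E n | ∀ i, c i ∈ Icc (-1 : ℝ) 1} := by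
    intro z hz
    obtain ⟨c, hc, rfl⟩ := F.exists_coord z hz
    exact ⟨c, fun i => abs_le.mp (hc i), rfl⟩
  refine (measure_mono h).trans ?_
  rw [volume_image_frame, ← ENNReal.ofReal_pow (by norm_num), ← ENNReal.ofReal_mul (by positivity)]
  refine le_of_eq ?_
  congr 1; norm_num; ring

omit A H in
lemma _root_.LinMA.frame_sub (F : IsFrame (closure (MASection Ω u x t)) s0 M)
    (hy : y ∈ closure (MASection Ω u x t)) (hz : z ∈ closure (MASection Ω u x t)) :
    ∃ c : E n, (∀ i, |c i| ≤ 2) ∧ z - y = toCLM M c := by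
  obtain ⟨a, ha, rfl⟩ := F.exists_coord z hz
  obtain ⟨b, hb, rfl⟩ := F.exists_coord y hy
  refine ⟨a - b, fun i => ?_, by rw [map_sub]; abel⟩
  have h1 := ha i
  have h2 := hb i
  rw [abs_le] at *
  simp only [PiLp.sub_apply]
  constructor <;> linarith

end Adm

/-- The set of slopes which vary by at most `r` on the section has volume comparable to
`(r / t) ^ n` times the volume of the section. -/
theorem exists_slope_const (hn : 0 < n) (hl : 0 < lam) : ∃ κ > 0, ∀ {Ω : Set (E n)} {u : E n → ℝ}
    {Lam : ℝ}, MAData Ω u lam Lam → ∀ {x : E n} {t : ℝ}, Adm Ω u x t → ∀ β > 0,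
    ENNReal.ofReal (κ * β ^ n * volume.real (MASection Ω u x t)) ≤
      volume {p : E n | ∀ z ∈ closure (MASection Ω u x t), |inner ℝ p (z - x)| ≤ β * t} := by
  have hn' : (0 : ℝ) < n := by exact_mod_cast hn
  refine ⟨lam / ((16 * n ^ 2) ^ n * 2 ^ n * n ^ n), by positivity, ?_⟩
  intro Ω u Lam H x t A β hβ
  obtain ⟨s0, M, F⟩ := A.exists_frame H
  have ht := A.pos
  have hdet := A.frame_det_sq_le H hn F
  have hvol := volume_le_frame F
  have hD : 0 < |M.det| := abs_pos.mpr F.det_ne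
  have hvr : volume.real (MASection Ω u x t) ≤ 2 ^ n * |M.det| :=
    ENNReal.toReal_le_of_le_ofReal (by positivity) ((measure_mono subset_closure).trans hvol)
  have hsub : toCLM M.transpose ⁻¹'
        {c : E n | ∀ i, c i ∈ Icc (-(β * t / (2 * n))) (β * t / (2 * n))}
      ⊆ {p : E n | ∀ z ∈ closure (MASection Ω u x t), |inner ℝ p (z - x)| ≤ β * t} := by
    intro p hp z hz
    obtain ⟨c, hc, h⟩ := frame_sub F (subset_closure A.self_mem) hz
    rw [h]
    refine (abs_inner_frame_le (r := β * t / (2 * n)) (fun i => abs_le.mpr (hp i)) hc).trans ?_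
    refine le_of_eq ?_
    field_simp
  refine le_trans ?_ (measure_mono hsub)
  rw [volume_preimage_frame F.det_ne, volume_box, ← ENNReal.ofReal_pow (by
    have : 0 < β * t / (2 * n) := by positivity
    linarith), ← ENNReal.ofReal_mul (by positivity)]
  refine ENNReal.ofReal_le_ofReal ?_
  have e1 : β * t / (2 * n) - -(β * t / (2 * n)) = β * t / n := by field_simp; ring
  rw [e1]
  calc lam / ((16 * n ^ 2) ^ n * 2 ^ n * n ^ n) * β ^ n * volume.real (MASection Ω u x t)
      ≤ lam / ((16 * n ^ 2) ^ n * 2 ^ n * n ^ n) * β ^ n * (2 ^ n * |M.det|) := by gcongr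
    _ = |M.det|⁻¹ * (lam / ((16 * n ^ 2) ^ n * n ^ n) * β ^ n * M.det ^ 2) := by
        rw [← sq_abs M.det]; field_simp
    _ ≤ |M.det|⁻¹ * (lam / ((16 * n ^ 2) ^ n * n ^ n) * β ^ n *
          ((16 * n ^ 2) ^ n / lam * t ^ n)) := by gcongr
    _ = |M.det|⁻¹ * (β * t / n) ^ n := by rw [div_pow, mul_pow β]; field_simp

/-- A slope `p` for which `f - p` has a value below its boundary values on a section is attained
by the gradient of `f` at a contact point, where the Hessian is nonnegative. -/
lemma Adm.exists_contact (A : Adm Ω u x t) (H : MAData Ω u lam Lam) {f : E n → ℝ}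
    (hf : ∀ z ∈ MASection Ω u x t, ContDiffAt ℝ 2 f z)
    (hfc : ContinuousOn f (closure (MASection Ω u x t))) {p : E n}
    (hy : y ∈ closure (MASection Ω u x t))
    (hb : ∀ z ∈ closure (MASection Ω u x t), z ∉ MASection Ω u x t →
      inner ℝ p (z - y) < f z - f y) :
    ∃ z ∈ MASection Ω u x t, grad f z = p ∧ (Hess f z).PosSemidef ∧
      ∀ w ∈ closure (MASection Ω u x t), f z + inner ℝ p (w - z) ≤ f w := by
  obtain ⟨z, hz, hmin, hall⟩ := A.exists_min H (f := fun w => f w - innerSL ℝ p w)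
    (hfc.sub (innerSL ℝ p).continuous.continuousOn) hy (fun z hz hzS => by
      have := hb z hz hzS
      rw [inner_sub_right] at this
      simp only [innerSL_apply_apply]
      linarith)
  refine ⟨z, hz, ?_, Hess_posSemidef_of_D2_nonneg (hf z hz)
    (D2_nonneg_of_isLocalMin_sub (hf z hz) hmin), fun w hw => ?_⟩
  · refine ext_inner_right ℝ fun h => ?_
    rw [inner_grad, fderiv_eq_of_isLocalMin_sub (hf z hz) hmin, innerSL_apply_apply]
  · have := hall w hw
    simp only [innerSL_apply_apply] at this
    rw [inner_sub_right]
    linarith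

/-- The engulfing property, in quantitative form. -/
theorem exists_engulf_const (hn : 0 < n) (hl : 0 < lam) (hL : 0 < Lam) : ∃ θ ≥ (1 : ℝ),
    ∀ {Ω : Set (E n)} {u : E n → ℝ}, MAData Ω u lam Lam → ∀ {x : E n} {t : ℝ}, Adm Ω u x t →
    ∀ y ∈ MASection Ω u x (t / 2), ∀ z ∈ MASection Ω u x t, bd u y z ≤ θ * t := by
  have hn' : (0 : ℝ) < n := by exact_mod_cast hn
  set N0 : ℝ := Lam * (512 * n ^ 3) ^ n / lam with hN0
  have hN0p : 0 < N0 := by positivity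
  refine ⟨1 + N0, by linarith, ?_⟩
  intro Ω u H x t A y hy2 z hz
  have ht := A.pos
  have hy : y ∈ MASection Ω u x t := section_mono (by linarith) hy2
  have hyΩ := A.subset hy
  obtain ⟨s0, M, F⟩ := A.exists_frame H
  have hdet := A.frame_det_sq_le H hn F
  have hvol := volume_le_frame F
  have hD : 0 < |M.det| := abs_pos.mpr F.det_ne
  set p0 := grad u y - grad u x with hp0
  have hbd : bd u y z = bd u x z - bd u x y - inner ℝ p0 (z - y) := by
    rw [bd_eq_of (x := x), inner_grad_sub]
  have hb1 := (mem_section.mp hz).2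
  have hb2 := H.bd_nonneg A.mem (subset_closure hyΩ)
  suffices hs : - inner ℝ p0 (z - y) ≤ N0 * t by rw [hbd]; linarith
  set N := - inner ℝ p0 (z - y) / t with hN
  have hNt : N * t = - inner ℝ p0 (z - y) := by rw [hN]; field_simp
  rw [← hNt]
  refine mul_le_mul_of_nonneg_right ?_ ht.le
  rcases le_or_gt N 0 with hN' | hNpos
  · linarith
  set w := toCLM M.transpose p0 with hw
  have : Nonempty (Fin n) := ⟨⟨0, hn⟩⟩
  obtain ⟨i, hi⟩ := Finite.exists_max fun i => |w i|
  obtain ⟨c, hc, hzy⟩ := frame_sub F (subset_closure hy) (subset_closure hz)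
  have hwi : N * t ≤ n * (|w i| * 2) := by
    rw [hNt, hzy]
    exact (neg_le_abs _).trans (abs_inner_frame_le hi hc)
  set a : ℝ := t / (16 * n) with ha
  have ha0 : 0 < a := by positivity
  set B : Matrix (Fin n) (Fin n) ℝ :=
    (a • (1 : Matrix (Fin n) (Fin n) ℝ)).updateCol i ((1 / 4 : ℝ) • w.ofLp) with hB
  have hBdet : B.det = a ^ (n - 1) * (w i / 4) := by
    rw [hB, ← Matrix.cramer_apply, Matrix.cramer_eq_adjugate_mulVec, Matrix.adjugate_smul,
      Matrix.adjugate_one, Matrix.smul_mulVec, Matrix.one_mulVec]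
    simp only [Pi.smul_apply, smul_eq_mul, Fintype.card_fin]
    ring
  set P := toCLM M.transpose ⁻¹'
      ((fun c => (0 : E n) + toCLM B c) '' {c : E n | ∀ j, c j ∈ Icc (0 : ℝ) 1})
    with hP
  have hsub : (fun g => g + grad u x) '' P ⊆ grad u '' MASection Ω u x t := by
    rintro _ ⟨g, ⟨c, hc, hg⟩, rfl⟩
    have hq : ∀ j, |(toCLM M.transpose (g - (c i / 4) • p0)) j| ≤ a := by
      intro j
      have e : (toCLM M.transpose (g - (c i / 4) • p0)) j = if j = i then 0 else a * c j := by
        rw [map_sub, map_smul, ← hg, ← hw]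
        simp only [zero_add, PiLp.sub_apply, PiLp.smul_apply, smul_eq_mul,
          Matrix.ofLp_toEuclideanCLM, Matrix.mulVec, dotProduct]
        rw [← Finset.add_sum_erase _ _ (Finset.mem_univ i)]
        have e2 : ∑ k ∈ Finset.univ.erase i, B j k * c k
            = ∑ k ∈ Finset.univ.erase i, (if j = k then a * c k else 0) := by
          refine Finset.sum_congr rfl fun k hk => ?_
          rw [hB, Matrix.updateCol_ne (Finset.ne_of_mem_erase hk)]
          simp [Matrix.one_apply]
        rw [e2, Finset.sum_ite_eq]
        simp [hB]
        split_ifs <;> ring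
      rw [e]
      split_ifs
      · simpa using ha0.le
      · have := hc j
        rw [abs_of_nonneg (mul_nonneg ha0.le this.1)]
        nlinarith [this.2]
    obtain ⟨z', hz', hgr, -⟩ := A.exists_contact H (f := u) (p := g + grad u x)
      (fun z hz => H.smooth z (A.subset hz))
      (H.cont.mono (A.cpt.2.trans subset_closure)) (subset_closure hy) (by
        intro z' hz' hz'S
        have h1 := A.le_bd hz' hz'S
        have h1' := A.bd_le H hz'
        have h2 := (mem_section.mp hy2).2
        obtain ⟨c', hc', hzy'⟩ := frame_sub F (subset_closure hy) hz'
        have h3 : |inner ℝ (g - (c i / 4) • p0) (z' - y)| ≤ n * (a * 2) := by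
          rw [hzy']; exact abs_inner_frame_le hq hc'
        have h4 : inner ℝ p0 (z' - y) ≤ t := by
          rw [hp0, inner_grad_sub]
          have := H.slope_le hyΩ (subset_closure (A.cpt.2 hz')) x
          linarith
        have h5 : n * (a * 2) = t / 8 := by rw [ha]; field_simp; norm_num
        rw [h5, inner_sub_left, inner_smul_left] at h3
        have h6 := (le_abs_self _).trans h3
        have h7 := hc i
        have h8 : c i / 4 * inner ℝ p0 (z' - y) ≤ t / 4 := by
          have : c i / 4 * inner ℝ p0 (z' - y) ≤ c i / 4 * t :=
            mul_le_mul_of_nonneg_left h4 (by linarith [h7.1])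
          nlinarith [h7.2]
        simp only [RCLike.conj_to_real] at h6
        rw [inner_add_left, inner_grad]
        have h9 : fderiv ℝ u x (z' - y) = fderiv ℝ u x (z' - x) - fderiv ℝ u x (y - x) := by
          rw [← map_sub]; congr 1; abel
        rw [h9]
        simp only [bd] at h1 h2
        linarith)
    exact ⟨z', hz', hgr⟩
  have hup := volume_grad_image_le (f := u) (c := Lam) (A.isOpen H).measurableSet
    (fun z hz => H.smooth z (A.subset hz)) (fun z hz => by
      rw [abs_of_pos (H.det_pos (A.subset hz))]; exact H.ub z (A.subset hz))
  have h1 := (measure_mono hsub).trans hup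
  rw [image_add_right, measure_preimage_add_right, hP, volume_preimage_frame F.det_ne,
    volume_image_frame] at h1
  have h2 := h1.trans (mul_le_mul_right ((measure_mono subset_closure).trans hvol) _)
  rw [sub_zero, ENNReal.ofReal_one, one_pow, mul_one, ← ENNReal.ofReal_mul (by positivity),
    ← ENNReal.ofReal_mul hL.le, ENNReal.ofReal_le_ofReal_iff (by positivity)] at h2
  have h3 : a ^ n * N ≤ |B.det| := by
    rw [hBdet, abs_mul, abs_of_pos (by positivity), abs_div, abs_of_pos (show (0 : ℝ) < 4 by
      norm_num)]
    obtain ⟨m, rfl⟩ : ∃ m, n = m + 1 := ⟨n - 1, by omega⟩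
    rw [pow_succ, mul_assoc, Nat.add_sub_cancel]
    refine mul_le_mul_of_nonneg_left ?_ (by positivity)
    have e : a * (16 * ((m + 1 : ℕ) : ℝ)) = t := by rw [ha]; field_simp
    refine le_of_mul_le_mul_left (a := 16 * ((m + 1 : ℕ) : ℝ)) ?_ (by positivity)
    nlinarith [abs_nonneg (w i)]
  have h4 : a ^ n * N ≤ Lam * (2 ^ n * M.det ^ 2) := by
    calc a ^ n * N ≤ |B.det| := h3
      _ = |M.det| * (|M.det|⁻¹ * |B.det|) := by field_simp
      _ ≤ |M.det| * (Lam * (2 ^ n * |M.det|)) := by gcongr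
      _ = Lam * (2 ^ n * M.det ^ 2) := by rw [← sq_abs M.det]; ring
  have h5 : a ^ n * N ≤ a ^ n * N0 := by
    calc a ^ n * N ≤ Lam * (2 ^ n * M.det ^ 2) := h4
      _ ≤ Lam * (2 ^ n * ((16 * n ^ 2) ^ n / lam * t ^ n)) := by gcongr
      _ = a ^ n * N0 := by
        have e : (512 * (n : ℝ) ^ 3) ^ n = 2 ^ n * (16 * n ^ 2) ^ n * (16 * n) ^ n := by
          rw [← mul_pow, ← mul_pow]; congr 1; ring
        rw [hN0, ha, e, div_pow]; field_simp
  exact le_of_mul_le_mul_left h5 (by positivity)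

end LinMA

namespace LinMA

open Set Filter Topology

variable {n : ℕ}

variable {Ω : Set (E n)} {u : E n → ℝ} {lam Lam θ : ℝ} {x y z w : E n} {r m s t : ℝ}

/-- Engulfing property of sections with constant `θ`. -/
def Engulf (Ω : Set (E n)) (u : E n → ℝ) (θ : ℝ) : Prop :=
  ∀ {x : E n} {t : ℝ}, Adm Ω u x t → ∀ y ∈ MASection Ω u x (t / 2), ∀ z ∈ MASection Ω u x t,
    bd u y z ≤ θ * t

namespace MAData

variable (H : MAData Ω u lam Lam)
include H

lemma continuousAt_bd (hx : x ∈ Ω) (hy : y ∈ Ω) :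
    ContinuousAt (fun q : E n × E n => bd u q.1 q.2) (x, y) := by
  have h1 : ContinuousAt (fun q : E n × E n => u q.2) (x, y) :=
    ContinuousAt.comp (f := Prod.snd) (H.differentiableAt hy).continuousAt continuousAt_snd
  have h2 : ContinuousAt (fun q : E n × E n => u q.1) (x, y) :=
    ContinuousAt.comp (f := Prod.fst) (H.differentiableAt hx).continuousAt continuousAt_fst
  have h3 : ContinuousAt (fun q : E n × E n => fderiv ℝ u q.1) (x, y) :=
    ContinuousAt.comp (f := Prod.fst) (g := fderiv ℝ u)
      (differentiableAt_fderiv (H.smooth x hx)).continuousAt continuousAt_fst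
  exact (h1.sub h2).sub (h3.clm_apply (continuousAt_snd.sub continuousAt_fst))

/-- A segment leaving a section meets its boundary. -/
lemma exists_boundary_point (hx : x ∈ Ω) (ht : 0 < t) (hy : y ∈ MASection Ω u x t) (hyΩ : y ∈ Ω)
    (hz : z ∈ closure Ω) (hzS : z ∉ MASection Ω u x t) :
    ∃ w ∈ closure (MASection Ω u x t) \ MASection Ω u x t, bd u y w ≤ bd u y z := by
  have hyc := subset_closure hyΩ
  have hc : ContinuousOn (fun s : ℝ => bd u x (y + s • (z - y))) (Icc 0 1) := by
    refine (H.bd_continuousOn x).comp (by fun_prop) fun s hs => H.line_mem hyc hz hs.1 hs.2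
  have h0 := (mem_section.mp hy).2
  have h1 : t ≤ bd u x z := by
    by_contra! h
    exact hzS (mem_section.mpr ⟨hz, h⟩)
  obtain ⟨s, hs, hst⟩ := intermediate_value_Icc zero_le_one hc
    (show t ∈ Icc _ _ by simpa using ⟨h0.le, h1⟩)
  have hmem := H.line_mem hyc hz hs.1 hs.2
  refine ⟨y + s • (z - y), ⟨H.mem_closure_section hx ht hmem hst.le, fun h => ?_⟩, ?_⟩
  · exact (mem_section.mp h).2.ne hst
  · have h2 := H.bd_line_le hyc hz hs.1 hs.2 y
    have h3 := H.bd_nonneg hyΩ hz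
    rw [bd_self] at h2
    nlinarith [hs.2]

variable (hE : Engulf Ω u θ) (hθ : 1 ≤ θ)
include hE hθ

lemma gap (A : Adm Ω u x t) (hy : y ∈ MASection Ω u x (t / (16 * θ ^ 2)))
    (hb : ∀ z ∈ closure (MASection Ω u x t) \ MASection Ω u x t, t / (4 * θ) < bd u y z)
    (hz : z ∈ closure (MASection Ω u x t) \ MASection Ω u x t) : t / θ ≤ bd u y z := by
  have ht := A.pos
  have hθ0 : 0 < θ := by linarith
  have hK : IsCompact (closure (MASection Ω u x t) \ MASection Ω u x t) := A.cpt.1.diff (A.isOpen H)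
  obtain ⟨z0, hz0, hmin⟩ := hK.exists_isMinOn ⟨z, hz⟩ (f := bd u y)
    ((H.bd_continuousOn y).mono (sdiff_subset.trans (A.cpt.2.trans subset_closure)))
  refine le_trans ?_ (hmin hz)
  have hm := hb z0 hz0
  set m := bd u y z0 with hm'
  have hm0 : 0 < m := lt_trans (by positivity) hm
  have hle : t / (16 * θ ^ 2) ≤ t := div_le_self ht.le (by nlinarith)
  have hyS := section_mono hle hy
  have hyΩ := A.subset hyS
  have hsub : MASection Ω u y m ⊆ MASection Ω u x t := by
    intro w hw
    by_contra hwS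
    obtain ⟨w', hw', hle'⟩ := H.exists_boundary_point A.mem ht hyS hyΩ (mem_section.mp hw).1 hwS
    exact absurd (hmin hw') (not_le.mpr (hle'.trans_lt (mem_section.mp hw).2))
  have A' := A.of_subset hyΩ hm0 hsub
  have hyx : bd u y x < m / 2 := by
    have A2 : Adm Ω u x (t / (8 * θ ^ 2)) :=
      A.mono (by positivity) (div_le_self ht.le (by nlinarith))
    have e : t / (8 * θ ^ 2) / 2 = t / (16 * θ ^ 2) := by field_simp; norm_num
    have h1 := hE A2 y (by rwa [e]) x A2.self_mem
    have e2 : θ * (t / (8 * θ ^ 2)) = t / (4 * θ) / 2 := by field_simp; norm_num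
    rw [e2] at h1
    linarith
  have hxm : x ∈ MASection Ω u y (m / 2) := mem_section.mpr ⟨subset_closure A.mem, hyx⟩
  have hz0c : z0 ∈ closure (MASection Ω u y m) :=
    H.mem_closure_section hyΩ hm0 (subset_closure (A.cpt.2 hz0.1)) le_rfl
  have h2 : bd u x z0 ≤ θ * m := by
    have hc : ContinuousWithinAt (bd u x) (MASection Ω u y m) z0 :=
      ((H.bd_continuousOn x) z0 (subset_closure (A.cpt.2 hz0.1))).mono
        (A'.subset.trans subset_closure)
    have := mem_closure_iff_nhdsWithin_neBot.mp hz0c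
    refine le_of_tendsto hc ?_
    filter_upwards [self_mem_nhdsWithin] with w hw using hE A' x hxm w hw
  have h3 := Adm.le_bd A hz0.1 hz0.2
  rw [div_le_iff₀ hθ0]
  linarith

/-- Sections centered near the center of a section are contained in it, at a comparable height. -/
lemma section_subset (A : Adm Ω u x t) (hy : y ∈ MASection Ω u x (t / (16 * θ ^ 2))) :
    MASection Ω u y (t / θ) ⊆ MASection Ω u x t := by
  have ht := A.pos
  have hθ0 : 0 < θ := by linarith
  set τ := t / (16 * θ ^ 2) with hτ
  have hle : τ ≤ t := div_le_self ht.le (by nlinarith)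
  have hτ0 : 0 < τ := by positivity
  have Aτ := A.mono hτ0 hle
  have hx := A.self_mem
  have hline : ∀ s ∈ Icc (0 : ℝ) 1, x + s • (y - x) ∈ MASection Ω u x τ := fun s hs =>
    (H.section_convex x τ).add_smul_sub_mem Aτ.self_mem hy hs
  set Bd := closure (MASection Ω u x t) \ MASection Ω u x t with hBd
  have hK : IsCompact Bd := A.cpt.1.diff (A.isOpen H)
  have hBΩ : ∀ z ∈ Bd, z ∈ Ω := fun z hz => A.cpt.2 hz.1
  set G : Set ℝ := {s | ∀ z ∈ Bd, t / θ ≤ bd u (x + s • (y - x)) z} with hG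
  have hcont : ∀ s ∈ Icc (0 : ℝ) 1, ∀ z ∈ Bd,
      ContinuousAt (fun q : ℝ × E n => bd u (x + q.1 • (y - x)) q.2) (s, z) := by
    intro s hs z hz
    have h1 := H.continuousAt_bd (Aτ.subset (hline s hs)) (hBΩ z hz)
    have h2 : ContinuousAt (fun q : ℝ × E n => (x + q.1 • (y - x), q.2)) (s, z) := by fun_prop
    exact ContinuousAt.comp (f := fun q : ℝ × E n => (x + q.1 • (y - x), q.2)) h1 h2
  have hclosed : IsClosed (G ∩ Icc 0 1) := by
    have e : G ∩ Icc 0 1 = Icc 0 1 ∩ ⋂ z ∈ Bd,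
        (Icc 0 1 ∩ (fun s : ℝ => bd u (x + s • (y - x)) z) ⁻¹' Ici (t / θ)) := by
      ext s
      simp only [hG, mem_inter_iff, mem_ofPred_eq, mem_iInter, mem_preimage, mem_Ici]
      exact ⟨fun h => ⟨h.2, fun z hz => ⟨h.2, h.1 z hz⟩⟩, fun h => ⟨fun z hz => (h.2 z hz).2, h.1⟩⟩
    rw [e]
    refine isClosed_Icc.inter (isClosed_biInter fun z hz => ?_)
    refine ContinuousOn.preimage_isClosed_of_isClosed (fun s hs => ?_) isClosed_Icc isClosed_Ici
    have h2 : ContinuousAt (fun s : ℝ => (s, z)) s := by fun_prop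
    exact (ContinuousAt.comp (f := fun s : ℝ => (s, z)) (hcont s hs z hz) h2).continuousWithinAt
  have h0 : (0 : ℝ) ∈ G := by
    intro z hz
    have := Adm.le_bd A hz.1 hz.2
    rw [zero_smul, add_zero]
    exact (div_le_self ht.le hθ).trans this
  have hstep : ∀ s ∈ G ∩ Ico 0 1, ∀ s' ∈ Ioi s, (G ∩ Ioc s s').Nonempty := by
    intro s hs s' hs'
    have hsI : s ∈ Icc (0 : ℝ) 1 := ⟨hs.2.1, hs.2.2.le⟩
    have hev : ∀ᶠ r in 𝓝 s, ∀ z ∈ Bd, t / (4 * θ) < bd u (x + r • (y - x)) z := by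
      refine hK.eventually_forall_of_forall_eventually fun z hz => ?_
      refine (hcont s hsI z hz).eventually (lt_mem_nhds ?_)
      refine lt_of_lt_of_le ?_ (hs.1 z hz)
      exact div_lt_div_of_pos_left ht hθ0 (by linarith)
    have hmin : s < min s' 1 := lt_min hs' hs.2.2
    obtain ⟨r, hr1, hr2⟩ := ((hev.filter_mono nhdsWithin_le_nhds).and
      (Ioc_mem_nhdsGT hmin)).exists
    have hrI : r ∈ Icc (0 : ℝ) 1 :=
      ⟨hs.2.1.trans hr2.1.le, hr2.2.trans (min_le_right _ _)⟩
    exact ⟨r, fun z hz => gap H hE hθ A (hline r hrI) hr1 hz, hr2.1, hr2.2.trans (min_le_left _ _)⟩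
  have hG1 := hclosed.Icc_subset_of_forall_exists_gt h0 hstep (right_mem_Icc.mpr zero_le_one)
  intro w hw
  by_contra hwS
  have hyS := section_mono hle hy
  obtain ⟨w', hw', hle'⟩ := H.exists_boundary_point A.mem ht hyS (A.subset hyS)
    (mem_section.mp hw).1 hwS
  have := hG1 w' hw'
  rw [one_smul, add_sub_cancel] at this
  linarith [(mem_section.mp hw).2]

lemma adm_of_mem (A : Adm Ω u x t) (hy : y ∈ MASection Ω u x (t / (16 * θ ^ 2))) (hs : 0 < s)
    (hst : s ≤ t / θ) : Adm Ω u y s := by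
  have ht := A.pos
  have hle : t / (16 * θ ^ 2) ≤ t := div_le_self ht.le (by nlinarith)
  exact A.of_subset (A.subset (section_mono hle hy)) hs
    ((section_mono hst).trans (H.section_subset hE hθ A hy))

omit H hθ in
lemma _root_.LinMA.Engulf.bd_symm_le (A : Adm Ω u x (2 * s)) (hy : y ∈ MASection Ω u x s) :
    bd u y x ≤ 2 * θ * s := by
  have := hE A y (by rwa [mul_div_cancel_left₀ _ two_ne_zero]) x A.self_mem
  linarith

omit H in
/-- Quasi-triangle inequality. -/
lemma _root_.LinMA.Engulf.bd_trans (Ax : Adm Ω u x (2 * s)) (Ay : Adm Ω u y (6 * θ * s))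
    (hy : y ∈ MASection Ω u x s) (hz : z ∈ MASection Ω u y s) :
    z ∈ MASection Ω u x (7 * θ ^ 2 * s) := by
  have hs : 0 < s := by linarith [Ax.pos]
  have h1 := hE.bd_symm_le Ax hy
  have hx : x ∈ MASection Ω u y (6 * θ * s / 2) :=
    mem_section.mpr ⟨subset_closure Ax.mem, by nlinarith⟩
  have h2 := hE Ay x hx z (section_mono (by nlinarith) hz)
  refine mem_section.mpr ⟨(mem_section.mp hz).1, ?_⟩
  nlinarith [mul_pos hs (show 0 < θ ^ 2 by positivity)]

omit hE hθ in
lemma le_volume_section (hy : y ∈ Ω) {B : Set (E n)} (hB : B ⊆ closure Ω)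
    (hm : ∀ z ∈ B, bd u y z ≤ m) (hr : 0 < r) (hrm : r ≤ 2 * m) :
    ENNReal.ofReal ((r / (2 * m)) ^ n) * volume B ≤ volume (MASection Ω u y r) := by
  have hm0 : 0 < m := by linarith
  have hη : 0 < r / (2 * m) := by positivity
  have h1 : AffineMap.homothety y (r / (2 * m)) '' B ⊆ MASection Ω u y r := by
    rintro _ ⟨z, hz, rfl⟩
    have e : AffineMap.homothety y (r / (2 * m)) z = y + (r / (2 * m)) • (z - y) := by
      simp [AffineMap.homothety_apply, add_comm]
    have hη1 : r / (2 * m) ≤ 1 := by rw [div_le_one (by positivity)]; exact hrm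
    rw [e]
    refine mem_section.mpr ⟨H.line_mem (subset_closure hy) (hB hz) hη.le hη1, ?_⟩
    have h2 := H.bd_line_le (subset_closure hy) (hB hz) hη.le hη1 y
    rw [bd_self] at h2
    have h3 : r / (2 * m) * bd u y z ≤ r / (2 * m) * m := by gcongr; exact hm z hz
    have h4 : r / (2 * m) * m = r / 2 := by field_simp
    linarith
  refine le_trans (le_of_eq ?_) (measure_mono h1)
  rw [Measure.addHaar_image_homothety, finrank_euclideanSpace_fin, abs_of_pos (pow_pos hη n)]

omit hE hθ in
lemma le_volume_real_section (A : Adm Ω u y r) {B : Set (E n)} (hB : B ⊆ closure Ω)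
    (hm : ∀ z ∈ B, bd u y z ≤ m) (hrm : r ≤ 2 * m) :
    (r / (2 * m)) ^ n * volume.real B ≤ volume.real (MASection Ω u y r) := by
  have h := H.le_volume_section A.mem hB hm A.pos hrm
  have h1 := ENNReal.toReal_mono A.volume_lt_top.ne h
  have hr := A.pos
  have hm0 : 0 < m := by linarith
  rwa [ENNReal.toReal_mul, ENNReal.toReal_ofReal (by positivity)] at h1

end MAData

end LinMA

namespace LinMA

open Set Filter Topology

variable {n : ℕ}

variable {Ω : Set (E n)} {u : E n → ℝ} {lam Lam θ κ : ℝ} {x y z w : E n} {r m s t : ℝ}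

section second_derivatives

variable {f g : E n → ℝ}

lemma continuousAt_D2 (hf : ContDiffAt ℝ 2 f x) : ContinuousAt (D2 f) x :=
  ((hf.fderiv_right (m := 1) (by norm_num)).fderiv_right (m := 0) (by norm_num)).continuousAt

lemma D2_add (hf : ContDiffAt ℝ 2 f x) (hg : ContDiffAt ℝ 2 g x) :
    D2 (fun y => f y + g y) x = D2 f x + D2 g x := by
  unfold D2
  have h : fderiv ℝ (fun y => f y + g y) =ᶠ[𝓝 x] fun y => fderiv ℝ f y + fderiv ℝ g y := by
    filter_upwards [hf.eventually (by simp), hg.eventually (by simp)] with y h1 h2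
    exact ((h1.differentiableAt (by norm_num)).hasFDerivAt.add
      (h2.differentiableAt (by norm_num)).hasFDerivAt).fderiv
  rw [h.fderiv_eq]
  exact ((differentiableAt_fderiv hf).hasFDerivAt.add
    (differentiableAt_fderiv hg).hasFDerivAt).fderiv

lemma D2_const_mul (hf : ContDiffAt ℝ 2 f x) (c : ℝ) :
    D2 (fun y => c * f y) x = c • D2 f x := by
  unfold D2
  have h : fderiv ℝ (fun y => c * f y) =ᶠ[𝓝 x] fun y => c • fderiv ℝ f y := by
    filter_upwards [hf.eventually (by simp)] with y h1
    exact ((h1.differentiableAt (by norm_num)).hasFDerivAt.const_mul c).fderiv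
  rw [h.fderiv_eq]
  exact ((differentiableAt_fderiv hf).hasFDerivAt.const_smul c).fderiv

lemma D2_const (c : ℝ) : D2 (fun _ : E n => c) x = 0 := by
  unfold D2
  have h : fderiv ℝ (fun _ : E n => c) = fun _ => 0 := by
    ext y; simp
  rw [h]
  simp

/-- The logarithm has Hessian `D²v / v - (Dv / v) ⊗ (Dv / v)`. -/
lemma D2_log (hf : ContDiffAt ℝ 2 f x) (h0 : ∀ᶠ y in 𝓝 x, f y ≠ 0) (h k : E n) :
    D2 (fun y => Real.log (f y)) x h k = (f x)⁻¹ * D2 f x h k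
      - fderiv ℝ (fun y => Real.log (f y)) x h * fderiv ℝ (fun y => Real.log (f y)) x k := by
  have hx := h0.self_of_nhds
  have h1 : fderiv ℝ (fun y => Real.log (f y)) =ᶠ[𝓝 x] fun y => (f y)⁻¹ • fderiv ℝ f y := by
    filter_upwards [hf.eventually (by simp), h0] with y h1 h2
    exact ((h1.differentiableAt (by norm_num)).hasFDerivAt.log h2).fderiv
  have hd := (hf.differentiableAt (by norm_num)).hasFDerivAt
  have h2 := ((hasDerivAt_inv hx).comp_hasFDerivAt x hd).smul
    (differentiableAt_fderiv hf).hasFDerivAt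
  rw [h1.self_of_nhds]
  unfold D2
  rw [h1.fderiv_eq]
  erw [h2.fderiv]
  simp
  field_simp
  ring

lemma measurableSet_inter_preimage {α : Type*} [TopologicalSpace α] {S : Set (E n)}
    (hS : IsOpen S) {F : E n → α} (hF : ContinuousOn F S) {C : Set α} (hC : IsClosed C) :
    MeasurableSet (S ∩ F ⁻¹' C) := by
  have h := (hF.isOpen_inter_preimage hS hC.isOpen_compl).measurableSet
  have e : S ∩ F ⁻¹' C = S \ (S ∩ F ⁻¹' Cᶜ) := by
    ext z; simp
  rw [e]
  exact hS.measurableSet.diff h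

/-- The points of `S` where the second derivative is nonnegative. -/
lemma measurableSet_D2_nonneg {S : Set (E n)} (hS : IsOpen S)
    (hf : ∀ z ∈ S, ContDiffAt ℝ 2 f z) : MeasurableSet (S ∩ {z | ∀ h, 0 ≤ D2 f z h h}) := by
  refine measurableSet_inter_preimage (F := D2 f) hS
    (fun z hz => (continuousAt_D2 (hf z hz)).continuousWithinAt) (C := {B | ∀ h, 0 ≤ B h h}) ?_
  have e : {B : E n →L[ℝ] E n →L[ℝ] ℝ | ∀ h, 0 ≤ B h h} = ⋂ h, {B | 0 ≤ B h h} := by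
    ext B; simp
  rw [e]
  exact isClosed_iInter fun h => isClosed_le continuous_const (by fun_prop)

end second_derivatives

/-- The linearized Monge-Ampère operator. -/
def Lop (u f : E n → ℝ) (z : E n) : ℝ := ∑ i, ∑ j, cofU u z i j * pd2 f z i j

section Lop

variable {f g : E n → ℝ}

lemma Lop_eq (hf : ContDiffAt ℝ 2 f z) : Lop u f z = ∑ i, ∑ j, cofU u z i j *
    D2 f z (EuclideanSpace.single i 1) (EuclideanSpace.single j 1) := by
  simp only [Lop, pd2_eq hf]

lemma Lop_add (hf : ContDiffAt ℝ 2 f z) (hg : ContDiffAt ℝ 2 g z) :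
    Lop u (fun y => f y + g y) z = Lop u f z + Lop u g z := by
  rw [Lop_eq hf, Lop_eq hg, Lop_eq (hf.add hg), D2_add hf hg]
  simp [mul_add, Finset.sum_add_distrib]

lemma Lop_const_mul (hf : ContDiffAt ℝ 2 f z) (c : ℝ) :
    Lop u (fun y => c * f y) z = c * Lop u f z := by
  rw [Lop_eq hf, Lop_eq (contDiffAt_const.mul hf), D2_const_mul hf]
  simp [Finset.mul_sum, mul_left_comm]

lemma Lop_const (c : ℝ) : Lop u (fun _ => c) z = 0 := by
  rw [Lop_eq contDiffAt_const, D2_const]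
  simp

lemma contDiffAt_bd (hu : ContDiffAt ℝ 2 u z) (x : E n) : ContDiffAt ℝ 2 (bd u x) z := by
  unfold bd
  fun_prop

lemma D2_bd (hu : ContDiffAt ℝ 2 u z) (x : E n) : D2 (bd u x) z = D2 u z := by
  have e : bd u x = fun y => (u y + (- u x + fderiv ℝ u x x)) - fderiv ℝ u x y := by
    ext y; simp [bd]; ring
  rw [e, D2_sub_clm (hu.add contDiffAt_const), D2_add hu contDiffAt_const, D2_const]
  ext h k
  exact add_zero (D2 u z h k)

lemma fderiv_bd (hu : DifferentiableAt ℝ u z) (x : E n) :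
    fderiv ℝ (bd u x) z = fderiv ℝ u z - fderiv ℝ u x := by
  have e : bd u x = fun y => (u y + (- u x + fderiv ℝ u x x)) - fderiv ℝ u x y := by
    ext y; simp [bd]; ring
  rw [e]
  exact ((hu.hasFDerivAt.add_const _).sub (fderiv ℝ u x).hasFDerivAt).fderiv

lemma Lop_bd (hu : ContDiffAt ℝ 2 u z) (x : E n) :
    Lop u (bd u x) z = n * (Hess u z).det := by
  have e : Lop u (bd u x) z = ∑ i, ∑ j, (Hess u z).adjugate i j * Hess u z i j := by
    rw [Lop_eq (contDiffAt_bd hu x), D2_bd hu]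
    simp only [cofU, Hess, pd2_eq hu, Matrix.of_apply]
  rw [e, adjugate_sum_eq_trace _ _ (Hess_isSymm hu), Matrix.adjugate_mul]
  simp [mul_comm]

end Lop

/-- Aleksandrov-Bakelman-Pucci estimate on a contact set. -/
lemma MAData.volume_slopes_le (H : MAData Ω u lam Lam) (hn : 0 < n) {Z P : Set (E n)}
    (hZ : MeasurableSet Z) (hZΩ : Z ⊆ Ω) {f : E n → ℝ} (hf : ∀ z ∈ Z, ContDiffAt ℝ 2 f z)
    (hpsd : ∀ z ∈ Z, (Hess f z).PosSemidef) (hL : ∀ z ∈ Z, Lop u f z ≤ n * (Hess u z).det)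
    (hP : P ⊆ grad f '' Z) : volume P ≤ ENNReal.ofReal Lam * volume Z := by
  refine (measure_mono hP).trans (volume_grad_image_le hZ hf fun z hz => ?_)
  rw [abs_of_nonneg (hpsd z hz).det_nonneg]
  have h := det_le_of_adjugate_trace_le (c := 1) hn (H.posSemidef (hZΩ hz)) (H.det_pos (hZΩ hz))
    (hpsd z hz) (by rw [one_mul]; exact hL z hz)
  rw [one_pow, one_mul] at h
  exact h.trans (H.ub z (hZΩ hz))

/-- Sections carry many slopes. -/
def SlopeBound (Ω : Set (E n)) (u : E n → ℝ) (κ : ℝ) : Prop :=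
  ∀ {x : E n} {t : ℝ}, Adm Ω u x t → ∀ β > 0,
    ENNReal.ofReal (κ * β ^ n * volume.real (MASection Ω u x t)) ≤
      volume {p : E n | ∀ z ∈ closure (MASection Ω u x t), |inner ℝ p (z - x)| ≤ β * t}

/-- `v` is a nonnegative supersolution on `W`. -/
def Super (u v : E n → ℝ) (W : Set (E n)) : Prop :=
  ∀ z ∈ W, ContDiffAt ℝ 2 v z ∧ 0 ≤ v z ∧ Lop u v z ≤ 0

lemma Super.mono {v : E n → ℝ} {V W : Set (E n)} (h : Super u v W) (hVW : V ⊆ W) :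
    Super u v V := fun z hz => h z (hVW hz)

lemma Super.continuousOn {v : E n → ℝ} {W : Set (E n)} (h : Super u v W) : ContinuousOn v W :=
  fun z hz => (h z hz).1.continuousAt.continuousWithinAt

/-- A nonnegative supersolution which is at most `a` at the center of a section is at most
`(1 + β) a` on a fixed proportion of it. -/
theorem Super.density (hn : 0 < n) (H : MAData Ω u lam Lam) (hS : SlopeBound Ω u κ)
    (A : Adm Ω u x t) {v : E n → ℝ} (hv : Super u v (closure (MASection Ω u x t)))
    {a β : ℝ} (ha : 0 < a) (hβ : 0 < β) (hvx : v x ≤ a) :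
    κ * (β / (4 * (1 + β))) ^ n * volume.real (MASection Ω u x t) ≤
      Lam * volume.real {z ∈ MASection Ω u x t | v z ≤ (1 + β) * a} := by
  have ht := A.pos
  set S := MASection Ω u x t with hSdef
  set k : ℝ := t / ((1 + β) * a) with hk
  have hk0 : 0 < k := by positivity
  have hka : k * ((1 + β) * a) = t := by rw [hk]; field_simp
  set b : ℝ := β / (4 * (1 + β)) with hb
  have hb0 : 0 < b := by positivity
  have hb4 : b * (4 * (1 + β)) = β := by rw [hb]; field_simp
  set f : E n → ℝ := fun y => bd u x y + k * v y with hf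
  have hSc : S ⊆ closure S := subset_closure
  have hfd : ∀ z ∈ closure S, ContDiffAt ℝ 2 f z := fun z hz =>
    (contDiffAt_bd (H.smooth z (A.cpt.2 hz)) x).add (contDiffAt_const.mul (hv z hz).1)
  set Z := (S ∩ {z | ∀ h, 0 ≤ D2 f z h h}) ∩ (S ∩ v ⁻¹' Iic ((1 + β) * a)) with hZ
  have hZm : MeasurableSet Z :=
    (measurableSet_D2_nonneg (A.isOpen H) fun z hz => hfd z (hSc hz)).inter
      (measurableSet_inter_preimage (A.isOpen H) (hv.mono hSc).continuousOn isClosed_Iic)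
  have hxc : x ∈ closure S := hSc A.self_mem
  have hP : {p : E n | ∀ z ∈ closure S, |inner ℝ p (z - x)| ≤ b * t} ⊆ grad f '' Z := by
    intro p hp
    have hfx : f x * (1 + β) ≤ t := by
      have : k * v x ≤ k * a := by gcongr
      simp only [hf, bd_self, zero_add]
      nlinarith
    have hbt : b * t * (4 * (1 + β)) = β * t := by linear_combination t * hb4
    obtain ⟨z, hz, hg, hpsd, hall⟩ := A.exists_contact H (f := f) (p := p)
      (fun z hz => hfd z (hSc hz))
      (fun z hz => (hfd z hz).continuousAt.continuousWithinAt) hxc (by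
        intro z hz hzS
        have h1 := (abs_le.mp (hp z hz)).2
        have h2 : t ≤ f z := by
          have h3 := A.le_bd hz hzS
          have h4 := mul_nonneg hk0.le (hv z hz).2.1
          simp only [hf]
          linarith
        refine h1.trans_lt ?_
        refine lt_of_mul_lt_mul_right ?_ (show 0 ≤ 4 * (1 + β) by positivity)
        nlinarith [mul_pos hβ ht])
    refine ⟨z, ⟨⟨hz, fun h => ?_⟩, hz, ?_⟩, hg⟩
    · rw [D2_eq_dotProduct (hfd z (hSc hz))]
      simpa using hpsd.dotProduct_mulVec_nonneg h.ofLp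
    · have h1 := hall x hxc
      have h2 := (abs_le.mp (hp z (hSc hz))).2
      have h3 : inner ℝ p (x - z) = - inner ℝ p (z - x) := by rw [← inner_neg_right, neg_sub]
      have h4 := H.bd_nonneg A.mem (subset_closure (A.subset hz))
      have h5 : k * v z ≤ f x + b * t := by
        have : f z = bd u x z + k * v z := rfl
        linarith
      have h6 : k * v z ≤ k * ((1 + β) * a) := by
        rw [hka]
        refine le_of_mul_le_mul_right ?_ (show 0 < 4 * (1 + β) by positivity)
        nlinarith [mul_pos hβ ht]
      exact le_of_mul_le_mul_left h6 hk0
  have h1 := H.volume_slopes_le hn hZm (fun z hz => A.subset hz.1.1)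
    (fun z hz => hfd z (hSc hz.1.1))
    (fun z hz => Hess_posSemidef_of_D2_nonneg (hfd z (hSc hz.1.1)) hz.1.2)
    (fun z hz => by
      have hzc := hSc hz.1.1
      have hu := H.smooth z (A.cpt.2 hzc)
      rw [hf, Lop_add (contDiffAt_bd hu x) (contDiffAt_const.mul (hv z hzc).1), Lop_bd hu,
        Lop_const_mul (hv z hzc).1]
      have := mul_nonpos_of_nonneg_of_nonpos hk0.le (hv z hzc).2.2
      linarith) hP
  have h2 := (hS A b hb0).trans h1
  have hsub : Z ⊆ {z ∈ S | v z ≤ (1 + β) * a} := fun z hz => ⟨hz.1.1, hz.2.2⟩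
  have hfin : volume {z ∈ S | v z ≤ (1 + β) * a} ≠ ⊤ :=
    ((measure_mono (sep_subset _ _)).trans_lt A.volume_lt_top).ne
  have h3 := h2.trans (mul_le_mul_right (measure_mono hsub) _)
  have hL := H.Lam_pos A.mem
  rw [← ENNReal.ofReal_toReal hfin, ← ENNReal.ofReal_mul hL.le,
    ENNReal.ofReal_le_ofReal_iff (by positivity)] at h3
  exact h3

lemma det_smul_id_add_smulRight {g : ℝ} (hg : 0 < g) (L : E n →L[ℝ] ℝ) (w : E n) :
    (g • ContinuousLinearMap.id ℝ (E n) + L.smulRight w).det = g ^ n * (1 + g⁻¹ * L w) := by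
  have e : ((g • ContinuousLinearMap.id ℝ (E n) + L.smulRight w : E n →L[ℝ] E n) :
      E n →ₗ[ℝ] E n) = g • LinearMap.transvection (g⁻¹ • (L : E n →ₗ[ℝ] ℝ)) w := by
    ext1 h
    simp only [LinearMap.smul_apply, LinearMap.transvection.apply,
      ContinuousLinearMap.coe_coe, add_apply, smul_apply,
      ContinuousLinearMap.id_apply, ContinuousLinearMap.smulRight_apply, smul_add, smul_smul,
      smul_eq_mul]
    rw [← mul_assoc, mul_inv_cancel₀ hg.ne', one_mul]
  rw [ContinuousLinearMap.det, e, LinearMap.det_smul, LinearMap.transvection.det,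
    finrank_euclideanSpace_fin]
  simp

/-- The set where the radial second derivative is large is small. -/
theorem MAData.volume_radial_le (H : MAData Ω u lam Lam) (hE : Engulf Ω u θ) (hθ : 1 ≤ θ)
    (hn : 0 < n)
    {T a N : ℝ} (A : Adm Ω u x (2 * T)) (ha : 0 < a) (hN : 0 ≤ N) {Z : Set (E n)}
    (hZ : MeasurableSet Z) (hZS : Z ⊆ MASection Ω u x T) (hZa : ∀ z ∈ Z, a * T ≤ bd u x z)
    (hZN : ∀ z ∈ Z, N * T ≤ D2 u z (z - x) (z - x)) :
    N * a ^ (n - 1) * volume.real Z ≤ (1 + 2 * θ) ^ n * volume.real (MASection Ω u x T) := by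
  have hT : 0 < T := by linarith [A.pos]
  have A1 : Adm Ω u x T := A.mono hT (by linarith)
  have hZΩ : Z ⊆ Ω := hZS.trans A1.subset
  set g : E n → ℝ := fun z => (fderiv ℝ u z - fderiv ℝ u x) (z - x) with hg
  have hgl : ∀ z ∈ Z, a * T ≤ g z := fun z hz => by
    have h1 := H.bd_nonneg (hZΩ hz) (subset_closure A.mem)
    have h2 := bd_add_bd (u := u) (x := x) (y := z)
    have h3 := hZa z hz
    simp only [hg]
    linarith
  have hgu : ∀ z ∈ Z, g z ≤ (1 + 2 * θ) * T := fun z hz => by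
    have h1 := hE.bd_symm_le A (hZS hz)
    have h2 := bd_add_bd (u := u) (x := x) (y := z)
    have h3 := (mem_section.mp (hZS hz)).2
    simp only [hg]
    linarith
  have haT : 0 < a * T := by positivity
  have hgp : ∀ z ∈ Z, 0 < g z := fun z hz => haT.trans_le (hgl z hz)
  set L : E n → E n →L[ℝ] ℝ := fun z =>
    (fderiv ℝ u z - fderiv ℝ u x).comp (ContinuousLinearMap.id ℝ (E n))
      + (D2 u z).flip (z - x) with hL
  have hgd : ∀ z ∈ Z, HasFDerivAt g (L z) z := fun z hz =>
    ((differentiableAt_fderiv (H.smooth z (hZΩ hz))).hasFDerivAt.sub_const _).clm_apply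
      ((hasFDerivAt_id z).sub_const x)
  set Ψ : E n → E n := fun z => x + g z • (z - x) with hΨ
  have hΨd : ∀ z ∈ Z, HasFDerivWithinAt Ψ
      (g z • ContinuousLinearMap.id ℝ (E n) + (L z).smulRight (z - x)) Z z := fun z hz =>
    (((hgd z hz).smul ((hasFDerivAt_id z).sub_const x)).const_add x).hasFDerivWithinAt
  have hinj : InjOn Ψ Z := by
    have key : ∀ z ∈ Z, ∀ z' ∈ Z, Ψ z = Ψ z' → g z' ≤ g z → z = z' := by
      intro z hz z' hz' h hle
      have hw : g z • (z - x) = g z' • (z' - x) := add_left_cancel h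
      set s := g z' / g z with hs
      have hgz := hgp z hz
      have hs0 : 0 < s := div_pos (hgp z' hz') hgz
      have hs1 : s ≤ 1 := (div_le_one hgz).mpr hle
      have hzs : z - x = s • (z' - x) := by
        rw [hs, div_eq_inv_mul, mul_smul, ← hw, smul_smul, inv_mul_cancel₀ hgz.ne', one_smul]
      rcases hs1.eq_or_lt with h1 | h1
      · rw [h1, one_smul] at hzs
        exact sub_left_injective hzs
      · exfalso
        have hmono : 0 ≤ (fderiv ℝ u z' - fderiv ℝ u z) (z' - z) := by
          rw [← bd_add_bd]
          exact add_nonneg (H.bd_nonneg (hZΩ hz) (subset_closure (hZΩ hz')))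
            (H.bd_nonneg (hZΩ hz') (subset_closure (hZΩ hz)))
        have e : z' - z = (1 - s) • (z' - x) := by
          rw [sub_smul, one_smul, ← hzs]; abel
        rw [e, map_smul, smul_eq_mul] at hmono
        have h2 : 0 ≤ (fderiv ℝ u z' - fderiv ℝ u z) (z' - x) :=
          nonneg_of_mul_nonneg_right hmono (by linarith)
        have h3 : g z = s * (fderiv ℝ u z - fderiv ℝ u x) (z' - x) := by
          simp only [hg]
          rw [hzs, map_smul, smul_eq_mul]
        have h4 : (fderiv ℝ u z - fderiv ℝ u x) (z' - x) ≤ g z' := by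
          simp only [hg, sub_apply] at h2 ⊢
          linarith
        have h5 : g z ≤ s * g z' := by rw [h3]; gcongr
        have h6 : s * g z' < g z' := by
          have := hgp z' hz'
          nlinarith
        linarith
    intro z hz z' hz' h
    rcases le_total (g z') (g z) with h1 | h1
    · exact key z hz z' hz' h h1
    · exact (key z' hz' z hz h.symm h1).symm
  have himg : Ψ '' Z ⊆ AffineMap.homothety x ((1 + 2 * θ) * T) '' MASection Ω u x T := by
    rintro _ ⟨z, hz, rfl⟩
    have h0 : 0 < (1 + 2 * θ) * T := (hgp z hz).trans_le (hgu z hz)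
    refine ⟨x + (g z / ((1 + 2 * θ) * T)) • (z - x), ?_, ?_⟩
    · exact (H.section_convex x T).add_smul_sub_mem A1.self_mem (hZS hz)
        ⟨(div_pos (hgp z hz) h0).le, (div_le_one h0).mpr (hgu z hz)⟩
    · simp only [hΨ, AffineMap.homothety_apply, vsub_eq_sub, vadd_eq_add, add_sub_cancel_left,
        smul_smul]
      rw [mul_div_cancel₀ _ h0.ne', add_comm]
  have hdet : ∀ z ∈ Z, (a * T) ^ (n - 1) * (N * T) ≤
      |(g z • ContinuousLinearMap.id ℝ (E n) + (L z).smulRight (z - x)).det| := by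
    intro z hz
    have hgz := hgp z hz
    have h1 : L z (z - x) = g z + D2 u z (z - x) (z - x) := rfl
    have h2 := hZN z hz
    have hNT : 0 ≤ N * T := by positivity
    have e : g z ^ n = g z ^ (n - 1) * g z := by rw [← pow_succ]; congr 1; omega
    rw [det_smul_id_add_smulRight hgz, h1]
    have h3 : g z ^ n * (1 + (g z)⁻¹ * (g z + D2 u z (z - x) (z - x)))
        = g z ^ (n - 1) * (2 * g z + D2 u z (z - x) (z - x)) := by
      rw [e]
      field_simp
      ring
    rw [h3]
    refine le_trans ?_ (le_abs_self _)
    have := hgl z hz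
    gcongr
    linarith
  have hfin : volume Z ≠ ⊤ := ((measure_mono hZS).trans_lt A1.volume_lt_top).ne
  have h1 : ENNReal.ofReal ((a * T) ^ (n - 1) * (N * T)) * volume Z ≤
      ENNReal.ofReal (|((1 + 2 * θ) * T) ^ n|) * volume (MASection Ω u x T) := by
    rw [← setLIntegral_const]
    refine (setLIntegral_mono' hZ fun z hz => ENNReal.ofReal_le_ofReal (hdet z hz)).trans ?_
    rw [lintegral_abs_det_fderiv_eq_addHaar_image volume hZ hΨd hinj]
    refine (measure_mono himg).trans (le_of_eq ?_)
    rw [Measure.addHaar_image_homothety, finrank_euclideanSpace_fin]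
  have h2 := ENNReal.toReal_mono (ENNReal.mul_ne_top ENNReal.ofReal_ne_top A1.volume_lt_top.ne) h1
  rw [ENNReal.toReal_mul, ENNReal.toReal_mul, ENNReal.toReal_ofReal (by positivity),
    ENNReal.toReal_ofReal (abs_nonneg _)] at h2
  change _ * volume.real Z ≤ _ * volume.real _ at h2
  rw [abs_of_nonneg (by positivity), mul_pow, mul_pow] at h2
  have e : T ^ n = T ^ (n - 1) * T := by rw [← pow_succ]; congr 1; omega
  refine le_of_mul_le_mul_right ?_ (pow_pos hT n)
  rw [e] at h2 ⊢
  linarith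

lemma sum_adjugate_mul_nonneg {M N : Matrix (Fin n) (Fin n) ℝ} (hM : M.PosSemidef)
    (hN : N.PosSemidef) : 0 ≤ ∑ i, ∑ j, M.adjugate i j * N i j := by
  have hNt : N.transpose = N := by
    have h1 := hN.1
    rwa [Matrix.IsHermitian, Matrix.conjTranspose_eq_transpose_of_trivial] at h1
  rw [adjugate_sum_eq_trace _ _ hNt]
  obtain ⟨B, rfl⟩ := exists_transpose_mul_self hM
  have h := (hN.mul_mul_conjTranspose_same B.adjugate.transpose).trace_nonneg
  rw [Matrix.conjTranspose_eq_transpose_of_trivial, Matrix.transpose_transpose] at h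
  rw [Matrix.adjugate_mul_distrib, ← Matrix.adjugate_transpose, Matrix.mul_assoc,
    Matrix.trace_mul_comm]
  exact h

/-- The quadratic form of the cofactor matrix on the gradient of `f`. -/
def Qf (u f : E n → ℝ) (z : E n) : ℝ := ∑ i, ∑ j, cofU u z i j * (pd f z i * pd f z j)

lemma MAData.Qf_nonneg (H : MAData Ω u lam Lam) (hz : z ∈ Ω) (f : E n → ℝ) : 0 ≤ Qf u f z := by
  have h := sum_adjugate_mul_nonneg (H.posSemidef hz)
    (Matrix.posSemidef_vecMulVec_self_star (pd f z))
  simpa [Matrix.vecMulVec_apply, Qf, cofU] using h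

lemma MAData.sq_fderiv_mul_det_le (H : MAData Ω u lam Lam) (hz : z ∈ Ω) (f : E n → ℝ) (h : E n) :
    (fderiv ℝ f z h) ^ 2 * (Hess u z).det ≤ Qf u f z * D2 u z h h := by
  have h1 := sq_dotProduct_mul_det_le (H.posSemidef hz) (pd f z) h.ofLp
  have e : pd f z ⬝ᵥ h.ofLp = fderiv ℝ f z h := by
    conv_rhs => rw [← sum_smul_single h]
    simp [dotProduct, pd, mul_comm]
  rw [e, ← D2_eq_dotProduct (H.smooth z hz)] at h1
  exact h1

lemma Lop_log {f : E n → ℝ} (hf : ContDiffAt ℝ 2 f z) (h0 : 0 < f z) :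
    Lop u (fun y => Real.log (f y)) z =
      (f z)⁻¹ * Lop u f z - Qf u (fun y => Real.log (f y)) z := by
  have hev : ∀ᶠ y in 𝓝 z, f y ≠ 0 := by
    filter_upwards [hf.continuousAt.eventually (lt_mem_nhds h0)] with y hy using hy.ne'
  rw [Lop_eq (hf.log h0.ne'), Lop_eq hf, Qf, Finset.mul_sum, ← Finset.sum_sub_distrib]
  refine Finset.sum_congr rfl fun i _ => ?_
  rw [Finset.mul_sum, ← Finset.sum_sub_distrib]
  refine Finset.sum_congr rfl fun j _ => ?_
  rw [D2_log hf hev]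
  simp only [pd]
  ring

lemma barrier (hn : 0 < n) (hθ : 1 ≤ θ) (H : MAData Ω u lam Lam) (hE : Engulf Ω u θ)
    (hS : SlopeBound Ω u κ) (A8 : Adm Ω u x (8 * t)) {v : E n → ℝ}
    (hv : Super u v (closure (MASection Ω u x (4 * t))))
    (h1 : ∀ z ∈ MASection Ω u x t, 1 ≤ v z) (hm : 0 < m) (hy : y ∈ MASection Ω u x (2 * t))
    (hvy : v y + Real.exp (-(3 * m)) < Real.exp (-(5 * m / 2))) :
    m * κ ≤ 16 * n * 4 ^ (n - 1) * (1 + 2 * θ) ^ n * Lam * 32 ^ n := by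
  have ht : 0 < t := by linarith [A8.pos]
  set T := 4 * t with hT
  have hT0 : 0 < T := by positivity
  have A4 : Adm Ω u x T := A8.mono hT0 (by linarith)
  have A2 : Adm Ω u x (2 * T) := by rwa [show 2 * T = 8 * t by rw [hT]; ring]
  set S := MASection Ω u x T with hSdef
  set ε := Real.exp (-(3 * m)) with hε
  have hε0 : 0 < ε := Real.exp_pos _
  set ψ : E n → ℝ := fun z => Real.log (v z + ε) with hψ
  set k := t / m with hk
  have hk0 : 0 < k := by positivity
  have hkm : k * m = t := by rw [hk]; field_simp
  set Φ : E n → ℝ := fun z => bd u x z + k * ψ z with hΦ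
  have hSc : S ⊆ closure S := subset_closure
  have hScΩ : closure S ⊆ Ω := A4.cpt.2
  have hvε : ∀ z ∈ closure S, 0 < v z + ε := fun z hz => by linarith [(hv z hz).2.1]
  have hvd : ∀ z ∈ closure S, ContDiffAt ℝ 2 (fun z => v z + ε) z := fun z hz =>
    (hv z hz).1.add contDiffAt_const
  have hψd : ∀ z ∈ closure S, ContDiffAt ℝ 2 ψ z := fun z hz => (hvd z hz).log (hvε z hz).ne'
  have hbdd : ∀ z ∈ closure S, ContDiffAt ℝ 2 (bd u x) z := fun z hz =>
    contDiffAt_bd (H.smooth z (hScΩ hz)) x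
  have hΦd : ∀ z ∈ closure S, ContDiffAt ℝ 2 Φ z := fun z hz =>
    (hbdd z hz).add (contDiffAt_const.mul (hψd z hz))
  have hψl : ∀ z ∈ closure S, -(3 * t) ≤ k * ψ z := by
    intro z hz
    have : -(3 * m) ≤ ψ z := by
      rw [hψ, Real.le_log_iff_exp_le (hvε z hz)]
      linarith [(hv z hz).2.1]
    nlinarith
  have hyS : y ∈ S := section_mono (by linarith) hy
  have hyc := hSc hyS
  have hΦy : Φ y ≤ -(t / 2) := by
    have h2 : ψ y ≤ -(5 * m / 2) := by
      rw [hψ, Real.log_le_iff_le_exp (hvε y hyc)]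
      exact hvy.le
    have h3 := (mem_section.mp hy).2
    have h4 : k * ψ y ≤ k * -(5 * m / 2) := by gcongr
    have h5 : Φ y = bd u x y + k * ψ y := rfl
    linarith
  have hLψ : ∀ z ∈ closure S, Lop u Φ z ≤ n * (Hess u z).det - k * Qf u ψ z := by
    intro z hz
    rw [hΦ, Lop_add (hbdd z hz) (contDiffAt_const.mul (hψd z hz)), Lop_bd (H.smooth z (hScΩ hz)),
      Lop_const_mul (hψd z hz), hψ, Lop_log (hvd z hz) (hvε z hz),
      Lop_add (hv z hz).1 contDiffAt_const, Lop_const]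
    have h2 : (v z + ε)⁻¹ * (Lop u v z + 0) ≤ 0 :=
      mul_nonpos_of_nonneg_of_nonpos (inv_pos.mpr (hvε z hz)).le
        (by rw [add_zero]; exact (hv z hz).2.2)
    nlinarith
  set N := m / (16 * n) with hN
  have hn' : (0 : ℝ) < n := by exact_mod_cast hn
  have hN0 : 0 < N := by positivity
  set Z := (S ∩ {z | ∀ h, 0 ≤ D2 Φ z h h}) ∩ ((S ∩ bd u x ⁻¹' Ici ((1 / 4) * T)) ∩
    (S ∩ (fun z => D2 u z (z - x) (z - x)) ⁻¹' Ici (N * T))) with hZ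
  have hSo := A4.isOpen H
  have hZm : MeasurableSet Z := by
    refine (measurableSet_D2_nonneg hSo fun z hz => hΦd z (hSc hz)).inter
      ((measurableSet_inter_preimage hSo (fun z hz => ?_) isClosed_Ici).inter
      (measurableSet_inter_preimage hSo (fun z hz => ?_) isClosed_Ici))
    · exact (hbdd z (hSc hz)).continuousAt.continuousWithinAt
    · refine ContinuousAt.continuousWithinAt ?_
      have h2 := continuousAt_D2 (H.smooth z (hScΩ (hSc hz)))
      have h3 : ContinuousAt (fun z : E n => z - x) z := by fun_prop
      exact (h2.clm_apply h3).clm_apply h3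
  have hxc : x ∈ closure S := hSc A4.self_mem
  have hP : {p : E n | ∀ z ∈ closure S, |inner ℝ p (z - x)| ≤ 1 / 32 * T} ⊆ grad Φ '' Z := by
    intro p hp
    obtain ⟨z, hz, hg, hpsd, hall⟩ := A4.exists_contact H (f := Φ) (p := p)
      (fun z hz => hΦd z (hSc hz))
      (fun z hz => (hΦd z hz).continuousAt.continuousWithinAt) hyc (by
        intro z hz hzS
        have h2 := (abs_le.mp (hp z hz)).2
        have h3 := (abs_le.mp (hp y hyc)).1
        have h4 : t ≤ Φ z := by
          have h5 := A4.le_bd hz hzS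
          have h6 := hψl z hz
          simp only [hΦ]
          linarith
        have h5 : inner ℝ p (z - y) = inner ℝ p (z - x) - inner ℝ p (y - x) := by
          rw [← inner_sub_right]; congr 1; abel
        linarith)
    have hzc := hSc hz
    have hzΩ := hScΩ hzc
    have hpz := (abs_le.mp (hp z hzc)).2
    have hΦz : Φ z < 0 := by
      have h2 := hall y hyc
      have h3 := (abs_le.mp (hp y hyc)).1
      have h5 : inner ℝ p (y - z) = inner ℝ p (y - x) - inner ℝ p (z - x) := by
        rw [← inner_sub_right]; congr 1; abel
      linarith
    have hbz : t ≤ bd u x z := by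
      by_contra! h
      have hzt : z ∈ MASection Ω u x t := mem_section.mpr ⟨subset_closure hzΩ, h⟩
      have h2 : 0 ≤ ψ z := Real.log_nonneg (by linarith [h1 z hzt])
      have h3 := H.bd_nonneg A4.mem (subset_closure hzΩ)
      have h4 : Φ z = bd u x z + k * ψ z := rfl
      nlinarith [mul_nonneg hk0.le h2]
    refine ⟨z, ⟨⟨hz, fun h => ?_⟩, ⟨hz, ?_⟩, hz, ?_⟩, hg⟩
    · rw [D2_eq_dotProduct (hΦd z hzc)]
      simpa using hpsd.dotProduct_mulVec_nonneg h.ofLp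
    · simp only [mem_preimage, mem_Ici]
      linarith
    · simp only [mem_preimage, mem_Ici]
      have hdu := H.differentiableAt hzΩ
      have hfd : fderiv ℝ Φ z = (fderiv ℝ u z - fderiv ℝ u x) + k • fderiv ℝ ψ z := by
        have h2 := ((hbdd z hzc).differentiableAt (by norm_num)).hasFDerivAt
        have h3 := ((hψd z hzc).differentiableAt (by norm_num)).hasFDerivAt
        rw [fderiv_bd hdu] at h2
        exact (h2.add (h3.const_mul k)).fderiv
      have hslope : k * fderiv ℝ ψ z (z - x) ≤ -(7 / 8 * t) := by
        have h2 : inner ℝ p (z - x) = (fderiv ℝ u z - fderiv ℝ u x) (z - x)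
            + k * fderiv ℝ ψ z (z - x) := by
          rw [← hg, inner_grad, hfd]
          rfl
        have h3 := bd_add_bd (u := u) (x := x) (y := z)
        have h4 := H.bd_nonneg hzΩ (subset_closure A4.mem)
        linarith
      have hsq : m ^ 2 / 4 ≤ (fderiv ℝ ψ z (z - x)) ^ 2 := by
        have h2 : fderiv ℝ ψ z (z - x) ≤ -(7 / 8 * m) := by
          refine le_of_mul_le_mul_left ?_ hk0
          rw [mul_neg, mul_left_comm, hkm]
          exact hslope
        nlinarith
      have hLn : 0 ≤ Lop u Φ z := by
        have := sum_adjugate_mul_nonneg (H.posSemidef hzΩ) hpsd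
        exact this
      have hQ : k * Qf u ψ z ≤ n * (Hess u z).det := by linarith [hLψ z hzc]
      have hcs := H.sq_fderiv_mul_det_le hzΩ ψ (z - x)
      have hD := H.D2_nonneg hzΩ (z - x)
      have hdet := H.det_pos hzΩ
      have h5 : k * (m ^ 2 / 4) * (Hess u z).det
          ≤ n * D2 u z (z - x) (z - x) * (Hess u z).det := by
        calc k * (m ^ 2 / 4) * (Hess u z).det
            ≤ k * (fderiv ℝ ψ z (z - x)) ^ 2 * (Hess u z).det := by gcongr
          _ = k * ((fderiv ℝ ψ z (z - x)) ^ 2 * (Hess u z).det) := by ring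
          _ ≤ k * (Qf u ψ z * D2 u z (z - x) (z - x)) := by gcongr
          _ = (k * Qf u ψ z) * D2 u z (z - x) (z - x) := by ring
          _ ≤ (n * (Hess u z).det) * D2 u z (z - x) (z - x) := by gcongr
          _ = _ := by ring
      have h6 := le_of_mul_le_mul_right h5 hdet
      have h7 : N * T = k * (m ^ 2 / 4) / n := by
        rw [hN, hT, ← hkm]; field_simp; ring
      rw [h7, div_le_iff₀ hn']
      linarith
  have h2 := H.volume_slopes_le hn hZm (fun z hz => A4.subset hz.1.1)
    (fun z hz => hΦd z (hSc hz.1.1))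
    (fun z hz => Hess_posSemidef_of_D2_nonneg (hΦd z (hSc hz.1.1)) hz.1.2)
    (fun z hz => by
      have h3 := hLψ z (hSc hz.1.1)
      have h4 := mul_nonneg hk0.le (H.Qf_nonneg (hScΩ (hSc hz.1.1)) ψ)
      linarith) hP
  have hfin : volume Z ≠ ⊤ :=
    ((measure_mono fun z hz => hz.1.1).trans_lt A4.volume_lt_top).ne
  have hL := H.Lam_pos A4.mem
  have h3 := (hS A4 (1 / 32) (by norm_num)).trans h2
  rw [← ENNReal.ofReal_toReal hfin, ← ENNReal.ofReal_mul hL.le,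
    ENNReal.ofReal_le_ofReal_iff (by positivity)] at h3
  change _ ≤ Lam * volume.real Z at h3
  have h4 := H.volume_radial_le hE hθ hn A2 (a := 1 / 4) (by norm_num) hN0.le hZm
    (fun z hz => hz.1.1) (fun z hz => hz.2.1.2) (fun z hz => hz.2.2.2)
  have hV := A4.volume_real_pos H
  refine le_of_mul_le_mul_right ?_ hV
  have e1 : κ * volume.real S ≤ 32 ^ n * (Lam * volume.real Z) := by
    have : 32 ^ n * (κ * (1 / 32) ^ n * volume.real S) = κ * volume.real S := by
      rw [one_div, inv_pow]; field_simp
    rw [← this]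
    gcongr
  have e2 : m * volume.real Z ≤ 16 * n * 4 ^ (n - 1) * ((1 + 2 * θ) ^ n * volume.real S) := by
    have : 16 * n * 4 ^ (n - 1) * (N * (1 / 4) ^ (n - 1) * volume.real Z)
        = m * volume.real Z := by
      rw [one_div, inv_pow, hN]; field_simp
    rw [← this]
    gcongr
  calc m * κ * volume.real S = m * (κ * volume.real S) := by ring
    _ ≤ m * (32 ^ n * (Lam * volume.real Z)) := by gcongr
    _ = 32 ^ n * Lam * (m * volume.real Z) := by ring
    _ ≤ 32 ^ n * Lam * (16 * n * 4 ^ (n - 1) * ((1 + 2 * θ) ^ n * volume.real S)) := by gcongr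
    _ = _ := by ring

/-- A supersolution which is at least `1` on a section is bounded below on its double. -/
theorem exists_double_const (hn : 0 < n) (hθ : 1 ≤ θ) (hκ : 0 < κ) (hL : 0 < Lam) :
    ∃ γ : ℝ, 0 < γ ∧ γ < 1 ∧ ∀ {Ω : Set (E n)} {u : E n → ℝ} {lam : ℝ}, MAData Ω u lam Lam →
      Engulf Ω u θ → SlopeBound Ω u κ → ∀ {x : E n} {t : ℝ}, Adm Ω u x (8 * t) →
      ∀ {v : E n → ℝ}, Super u v (closure (MASection Ω u x (4 * t))) →
      (∀ z ∈ MASection Ω u x t, 1 ≤ v z) → ∀ z ∈ MASection Ω u x (2 * t), γ ≤ v z := by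
  set m := 16 * n * 4 ^ (n - 1) * (1 + 2 * θ) ^ n * Lam * 32 ^ n / κ + 1 with hm
  have hm0 : 0 < m := by positivity
  refine ⟨Real.exp (-(5 * m / 2)) - Real.exp (-(3 * m)), ?_, ?_, ?_⟩
  · rw [sub_pos, Real.exp_lt_exp]; linarith
  · have h1 : Real.exp (-(5 * m / 2)) < 1 := by rw [Real.exp_lt_one_iff]; linarith
    linarith [Real.exp_pos (-(3 * m))]
  · intro Ω u lam H hE hS x t A8 v hv h1 z hz
    by_contra! h
    have h2 := barrier hn hθ H hE hS A8 hv h1 hm0 hz (by linarith)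
    have h3 : m * κ = 16 * n * 4 ^ (n - 1) * (1 + 2 * θ) ^ n * Lam * 32 ^ n + κ := by
      rw [hm]; field_simp
    linarith

end LinMA

namespace LinMA

open Set Filter Topology

variable {n : ℕ}

variable {Ω : Set (E n)} {u v : E n → ℝ} {lam Lam θ κ γ : ℝ} {x y z w : E n} {r m s t : ℝ}

lemma MAData.bd_pos (H : MAData Ω u lam Lam) (A : Adm Ω u y t)
    (hz : z ∈ closure (MASection Ω u y t)) (hzy : z ≠ y) : 0 < bd u y z := by
  have hzΩ := A.cpt.2 hz
  refine (H.bd_nonneg A.mem (subset_closure hzΩ)).lt_of_ne fun h => hzy ?_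
  have hzS : z ∈ MASection Ω u y t :=
    mem_section.mpr ⟨subset_closure hzΩ, by rw [← h]; exact A.pos⟩
  refine H.grad_injOn (H.section_convex y t) A.subset hzS A.self_mem ?_
  have hm : IsLocalMin (fun w => u w - fderiv ℝ u y w) z := by
    filter_upwards [H.isOpen.mem_nhds hzΩ] with w hw
    have h1 := H.bd_nonneg A.mem (subset_closure hw)
    simp only [bd, map_sub] at h h1
    linarith
  have := fderiv_eq_of_isLocalMin_sub (H.smooth z hzΩ) hm
  simp only [grad, this]

/-- Sections shrink to their center. -/
lemma MAData.exists_section_subset (H : MAData Ω u lam Lam) (A : Adm Ω u y t) {W : Set (E n)}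
    (hW : IsOpen W) (hy : y ∈ W) : ∃ s > 0, MASection Ω u y s ⊆ W := by
  have hK : IsCompact (closure (MASection Ω u y t) \ W) := A.cpt.1.diff hW
  rcases (closure (MASection Ω u y t) \ W).eq_empty_or_nonempty with h | h
  · exact ⟨t, A.pos, fun z hz => by_contra fun hzW =>
      h.subset (⟨subset_closure hz, hzW⟩ : z ∈ closure (MASection Ω u y t) \ W)⟩
  · obtain ⟨z0, hz0, hmin⟩ := hK.exists_isMinOn h (f := bd u y)
      ((H.bd_continuousOn y).mono (sdiff_subset.trans (A.cpt.2.trans subset_closure)))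
    have hp := H.bd_pos A hz0.1 (fun h => hz0.2 (h ▸ hy))
    refine ⟨min t (bd u y z0), lt_min A.pos hp, fun z hz => by_contra fun hzW => ?_⟩
    have h1 := section_mono (min_le_left _ _) hz
    have h2 := hmin (⟨subset_closure h1, hzW⟩ : z ∈ closure (MASection Ω u y t) \ W)
    have h3 := (mem_section.mp hz).2
    exact absurd (h3.trans_le (min_le_right _ _)) (not_lt.mpr h2)

lemma Super.const_mul {W : Set (E n)} (h : Super u v W) {c : ℝ} (hc : 0 ≤ c) :
    Super u (fun z => c * v z) W := fun z hz => by
  obtain ⟨h1, h2, h3⟩ := h z hz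
  refine ⟨contDiffAt_const.mul h1, mul_nonneg hc h2, ?_⟩
  rw [Lop_const_mul h1]
  exact mul_nonpos_of_nonneg_of_nonpos hc h3

/-- The properties of sections and supersolutions on which the Harnack inequality rests. -/
structure Geom (Ω : Set (E n)) (u : E n → ℝ) (lam Lam θ κ γ : ℝ) : Prop where
  dim : 0 < n
  data : MAData Ω u lam Lam
  one_le : 1 ≤ θ
  engulf : Engulf Ω u θ
  slope_pos : 0 < κ
  slope : SlopeBound Ω u κ
  pos : 0 < γ
  lt_one : γ < 1
  double : ∀ {x : E n} {t : ℝ}, Adm Ω u x (8 * t) →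
      ∀ {v : E n → ℝ}, Super u v (closure (MASection Ω u x (4 * t))) →
      (∀ z ∈ MASection Ω u x t, 1 ≤ v z) → ∀ z ∈ MASection Ω u x (2 * t), γ ≤ v z

theorem exists_geom_const (hn : 0 < n) (hl : 0 < lam) (hlL : lam ≤ Lam) :
    ∃ θ κ γ : ℝ, 1 ≤ θ ∧ 0 < κ ∧ 0 < γ ∧ γ < 1 ∧ ∀ {Ω : Set (E n)} {u : E n → ℝ},
      MAData Ω u lam Lam → Geom Ω u lam Lam θ κ γ := by
  have hL : 0 < Lam := hl.trans_le hlL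
  obtain ⟨θ, hθ, hE⟩ := exists_engulf_const hn hl hL
  obtain ⟨κ, hκ, hS⟩ := exists_slope_const hn hl
  obtain ⟨γ, h0, h1, hD⟩ := exists_double_const hn hθ hκ hL
  refine ⟨θ, κ, γ, hθ, hκ, h0, h1, fun {Ω u} H => ?_⟩
  have hE' : Engulf Ω u θ := fun {x t} A => hE H A
  have hS' : SlopeBound Ω u κ := fun {x t} A => hS H A
  exact ⟨hn, H, hθ, hE', hκ, hS', h0, h1, fun {x t} A {v} hv => hD H hE' hS' A hv⟩

namespace Geom

variable (G : Geom Ω u lam Lam θ κ γ)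
include G

lemma double_mul {c : ℝ} (A : Adm Ω u x (8 * t))
    (hv : Super u v (closure (MASection Ω u x (4 * t)))) (hc : 0 < c)
    (h : ∀ z ∈ MASection Ω u x t, c ≤ v z) : ∀ z ∈ MASection Ω u x (2 * t), γ * c ≤ v z := by
  intro z hz
  have h1 := G.double A (hv.const_mul (inv_pos.mpr hc).le)
    (fun z hz => by rw [inv_mul_eq_div, one_le_div hc]; exact h z hz) z hz
  rwa [inv_mul_eq_div, le_div_iff₀ hc] at h1

lemma double_iterate {c : ℝ} (hc : 0 < c) (h : ∀ z ∈ MASection Ω u x t, c ≤ v z) (i : ℕ)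
    (A : Adm Ω u x (4 * (2 ^ i * t)))
    (hv : Super u v (closure (MASection Ω u x (2 * (2 ^ i * t))))) :
    ∀ z ∈ MASection Ω u x (2 ^ i * t), γ ^ i * c ≤ v z := by
  induction i with
  | zero => simpa using h
  | succ i ih =>
    have hp : 0 < 2 ^ i * t := by
      have := A.pos
      rw [pow_succ] at this
      linarith
    have e : 2 ^ (i + 1) * t = 2 * (2 ^ i * t) := by ring
    rw [e] at A hv ⊢
    have ih' := ih (A.mono (by positivity) (by linarith))
      (hv.mono (closure_mono (section_mono (by linarith))))
    rw [pow_succ', mul_assoc]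
    refine G.double_mul (by convert A using 1; ring) (hv.mono ?_) (mul_pos (pow_pos G.pos i) hc) ih'
    exact closure_mono (section_mono (by linarith))

/-- A lower bound on a section propagates to larger sections. -/
lemma lower_bound {c a σ : ℝ} (hc : 0 < c) (h : ∀ z ∈ MASection Ω u x a, c ≤ v z) (i : ℕ)
    (hi : σ ≤ 2 ^ i * a) (A : Adm Ω u x (4 * σ))
    (hv : Super u v (closure (MASection Ω u x (2 * σ)))) :
    ∀ z ∈ MASection Ω u x σ, γ ^ i * c ≤ v z := by
  have e : 2 ^ i * (σ / 2 ^ i) = σ := by field_simp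
  have hle : σ / 2 ^ i ≤ a := by
    rw [div_le_iff₀ (by positivity)]; linarith
  have := G.double_iterate hc (fun z hz => h z (section_mono hle hz)) i
    (by rwa [e]) (by rwa [e])
  rwa [e] at this

/-- A supersolution which is large on most of a section is large near its center. -/
lemma large_of_density {δ N : ℝ} (hN : 0 < N) (hδ : Lam * δ < κ * (1 / (16 * θ ^ 2)) ^ n)
    (A : Adm Ω u y s) (hv : Super u v (closure (MASection Ω u y s)))
    (hd : volume.real {z ∈ MASection Ω u y s | v z ≤ N} ≤ δ * volume.real (MASection Ω u y s)) :
    ∀ z ∈ MASection Ω u y (s / (16 * θ ^ 2)), N / 2 ≤ v z := by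
  intro z hz
  by_contra! h
  have hs := A.pos
  have hθ := G.one_le
  have hθ0 : 0 < θ := by linarith
  have H := G.data
  have A' := H.adm_of_mem G.engulf hθ A hz (show 0 < s / θ by positivity) le_rfl
  have hsub := H.section_subset G.engulf hθ A hz
  have h1 := Super.density G.dim H G.slope A' (hv.mono (closure_mono hsub)) (half_pos hN)
    one_pos h.le
  have h2 : (1 + 1) * (N / 2) = N := by ring
  have h3 : volume.real {w ∈ MASection Ω u z (s / θ) | v w ≤ N} ≤
      volume.real {w ∈ MASection Ω u y s | v w ≤ N} := by
    refine measureReal_mono (fun w hw => ⟨hsub hw.1, hw.2⟩) ?_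
    exact ((measure_mono (sep_subset _ _)).trans_lt A.volume_lt_top).ne
  have hz2 : z ∈ MASection Ω u y (s / 2) := section_mono (by
    rw [div_le_div_iff_of_pos_left hs (by positivity) (by positivity)]; nlinarith) hz
  have h4 := H.le_volume_real_section A' (B := MASection Ω u y s) (m := θ * s)
    (A.subset.trans subset_closure) (fun w hw => G.engulf A z hz2 w hw) (by
      rw [div_le_iff₀ hθ0]; nlinarith [one_le_pow₀ hθ (n := 2)])
  have e : s / θ / (2 * (θ * s)) = 1 / (2 * θ ^ 2) := by field_simp
  rw [e] at h4
  rw [h2] at h1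
  have hL := H.Lam_pos A.mem
  have hV := A.volume_real_pos H
  have hκ := G.slope_pos
  have h5 : κ * (1 / (16 * θ ^ 2)) ^ n * volume.real (MASection Ω u y s) ≤
      Lam * δ * volume.real (MASection Ω u y s) := by
    calc κ * (1 / (16 * θ ^ 2)) ^ n * volume.real (MASection Ω u y s)
        = κ * (1 / (4 * (1 + 1))) ^ n
            * ((1 / (2 * θ ^ 2)) ^ n * volume.real (MASection Ω u y s)) := by
          have : (1 / (16 * θ ^ 2)) ^ n = (1 / (4 * (1 + 1))) ^ n * (1 / (2 * θ ^ 2)) ^ n := by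
            rw [← mul_pow]; congr 1; field_simp; norm_num
          rw [this]; ring
      _ ≤ κ * (1 / (4 * (1 + 1))) ^ n * volume.real (MASection Ω u z (s / θ)) := by gcongr
      _ ≤ _ := h1
      _ ≤ Lam * (δ * volume.real (MASection Ω u y s)) := by
          gcongr
          exact h3.trans hd
      _ = _ := by ring
  have := le_of_mul_le_mul_right h5 hV
  linarith

/-- Sections centered in the core of a section. -/
lemma adm (A : Adm Ω u x t) (hy : y ∈ MASection Ω u x (t / (16 * θ ^ 2))) (hs : 0 < s)
    (hst : s ≤ t / θ) : Adm Ω u y s := G.data.adm_of_mem G.engulf G.one_le A hy hs hst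

lemma section_subset (A : Adm Ω u x t) (hy : y ∈ MASection Ω u x (t / (16 * θ ^ 2)))
    (hst : s ≤ t / θ) : MASection Ω u y s ⊆ MASection Ω u x t :=
  (section_mono hst).trans (G.data.section_subset G.engulf G.one_le A hy)

lemma self_mem_core (A : Adm Ω u x t) : x ∈ MASection Ω u x (t / (16 * θ ^ 2)) := by
  have := A.pos
  have := G.one_le
  exact mem_section.mpr ⟨subset_closure A.mem, by rw [bd_self]; positivity⟩

/-- The quasi-triangle inequality for centers in the core of a section. -/
lemma mem_of_mem (A : Adm Ω u w t) (hx : x ∈ MASection Ω u w (t / (16 * θ ^ 2)))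
    (hy : y ∈ MASection Ω u w (t / (16 * θ ^ 2))) (hs : 0 < s) (hst : 6 * θ * s ≤ t / θ)
    (hyx : y ∈ MASection Ω u x s) (hz : z ∈ MASection Ω u y s) :
    z ∈ MASection Ω u x (7 * θ ^ 2 * s) := by
  have hθ := G.one_le
  exact Engulf.bd_trans G.engulf hθ (G.adm A hx (by positivity) (by nlinarith))
    (G.adm A hy (by positivity) hst) hyx hz

end Geom

namespace Geom

variable (G : Geom Ω u lam Lam θ κ γ)
include G

/-- If every point of `X` is the center of a section inside `Y` a fixed proportion of which lies
outside `X`, then `Y \ X` has at least a fixed proportion of the measure of `X`. -/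
theorem covering (A : Adm Ω u x t) {X Y : Set (E n)} (hX : MeasurableSet X)
    (hXU : X ⊆ MASection Ω u x (t / (16 * θ ^ 2))) (hYU : Y ⊆ MASection Ω u x (t / (16 * θ ^ 2)))
    {δ : ℝ} {r : E n → ℝ} (hr0 : ∀ y ∈ X, 0 < r y) (hr : ∀ y ∈ X, 30 * θ ^ 3 * r y ≤ t)
    (hrY : ∀ y ∈ X, MASection Ω u y (r y) ⊆ Y)
    (hd : ∀ y ∈ X, ENNReal.ofReal δ * volume (MASection Ω u y (r y)) ≤
      volume (MASection Ω u y (r y) \ X)) (hδ : 0 ≤ δ) :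
    ENNReal.ofReal (δ * (1 / (70 * θ ^ 3)) ^ n) * volume X ≤ volume (Y \ X) := by
  have hθ := G.one_le
  have hθ0 : 0 < θ := by linarith
  have ht := A.pos
  have H := G.data
  have hadm : ∀ y ∈ X, Adm Ω u y (2 * r y) := fun y hy => G.adm A (hXU hy)
    (by linarith [hr0 y hy]) (by
      rw [le_div_iff₀ hθ0]
      have h1 := hr y hy
      have h2 := hr0 y hy
      have h3 : θ ≤ θ ^ 3 := le_self_pow₀ hθ (by norm_num)
      nlinarith)
  have hadm1 : ∀ y ∈ X, Adm Ω u y (r y) := fun y hy =>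
    (hadm y hy).mono (hr0 y hy) (by linarith [hr0 y hy])
  obtain ⟨I, hIX, hdisj, hcov⟩ := Vitali.exists_disjoint_subfamily_covering_enlargement
    (fun y => MASection Ω u y (r y)) X r 2 one_lt_two (fun y hy => (hr0 y hy).le)
    t (fun y hy => by
      have h1 := hr y hy
      have h2 := hr0 y hy
      have h3 : 1 ≤ θ ^ 3 := one_le_pow₀ hθ
      nlinarith) (fun y hy => ⟨y, (hadm1 y hy).self_mem⟩)
  have hIc : I.Countable := hdisj.countable_of_isOpen
    (fun y hy => (hadm1 y (hIX hy)).isOpen H) (fun y hy => ⟨y, (hadm1 y (hIX hy)).self_mem⟩)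
  have hXc : X ⊆ ⋃ b ∈ I, MASection Ω u b (35 * θ ^ 3 * r b) := by
    intro a ha
    obtain ⟨b, hb, ⟨w, hwa, hwb⟩, hab⟩ := hcov a ha
    have hbX := hIX hb
    have hrb := hr0 b hbX
    refine mem_biUnion hb ?_
    have h1 : bd u w a ≤ 2 * θ * r a := Engulf.bd_symm_le G.engulf (hadm a ha) hwa
    have h2 : a ∈ MASection Ω u w (5 * θ * r b) :=
      mem_section.mpr ⟨subset_closure (hadm a ha).mem, by nlinarith [mul_pos hθ0 hrb]⟩
    have h3 := G.mem_of_mem A (hXU hbX) (hYU (hrY b hbX hwb)) (s := 5 * θ * r b)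
      (by positivity) (by
        rw [le_div_iff₀ hθ0]
        have := hr b hbX
        linarith) (section_mono (by nlinarith) hwb) h2
    rwa [show 7 * θ ^ 2 * (5 * θ * r b) = 35 * θ ^ 3 * r b by ring] at h3
  have hterm : ∀ b ∈ X, ENNReal.ofReal (δ * (1 / (70 * θ ^ 3)) ^ n) *
      volume (MASection Ω u b (35 * θ ^ 3 * r b)) ≤ volume (MASection Ω u b (r b) \ X) := by
    intro b hb
    have hrb := hr0 b hb
    have h1 := H.le_volume_section (m := 35 * θ ^ 3 * r b) (r := r b) (hadm b hb).mem
      (B := MASection Ω u b (35 * θ ^ 3 * r b)) (fun z hz => (mem_section.mp hz).1)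
      (fun z hz => (mem_section.mp hz).2.le) hrb (by nlinarith [one_le_pow₀ hθ (n := 3)])
    have e : r b / (2 * (35 * θ ^ 3 * r b)) = 1 / (70 * θ ^ 3) := by field_simp; norm_num
    rw [e] at h1
    rw [ENNReal.ofReal_mul hδ, mul_assoc]
    exact (mul_le_mul_right h1 _).trans (hd b hb)
  calc ENNReal.ofReal (δ * (1 / (70 * θ ^ 3)) ^ n) * volume X
      ≤ ENNReal.ofReal (δ * (1 / (70 * θ ^ 3)) ^ n) *
          ∑' b : I, volume (MASection Ω u b (35 * θ ^ 3 * r b)) := by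
        gcongr
        exact (measure_mono hXc).trans (measure_biUnion_le _ hIc _)
    _ = ∑' b : I, ENNReal.ofReal (δ * (1 / (70 * θ ^ 3)) ^ n) *
          volume (MASection Ω u b (35 * θ ^ 3 * r b)) := ENNReal.tsum_mul_left.symm
    _ ≤ ∑' b : I, volume (MASection Ω u b (r b) \ X) :=
        ENNReal.tsum_le_tsum fun b => hterm b (hIX b.2)
    _ = volume (⋃ b ∈ I, MASection Ω u b (r b) \ X) := by
        refine (measure_biUnion (μ := volume) (f := fun b => MASection Ω u b (r b) \ X) hIc
          (fun a ha b hb hab => ?_) fun b hb => ?_).symm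
        · exact (hdisj ha hb hab).mono sdiff_subset sdiff_subset
        · exact ((hadm1 b (hIX hb)).measurableSet H).diff hX
    _ ≤ volume (Y \ X) := measure_mono (iUnion₂_subset fun b hb =>
        sdiff_subset_sdiff_left (hrY b (hIX hb)))

omit G in
lemma exists_two_pow_ge (c : ℝ) : ∃ J : ℕ, c ≤ 2 ^ J := by
  obtain ⟨J, hJ⟩ := pow_unbounded_of_one_lt c one_lt_two
  exact ⟨J, hJ.le⟩

/-- A stopping section around a point where the supersolution is large. -/
lemma exists_stopping {δ N e : ℝ} {J : ℕ} (hJ : 32 * θ ^ 2 ≤ 2 ^ J) (hδ0 : 0 ≤ δ)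
    (hδ : Lam * δ < κ * (1 / (16 * θ ^ 2)) ^ n) (hN : 0 < N)
    (A : Adm Ω u y (4 * e)) (hv : Super u v (closure (MASection Ω u y (2 * e)))) (hy : N < v y)
    (hbad : δ * volume.real (MASection Ω u y e) < volume.real {z ∈ MASection Ω u y e | v z ≤ N}) :
    ∃ r, 0 < r ∧ r ≤ e ∧ (∀ z ∈ MASection Ω u y r, γ ^ J * (N / 2) ≤ v z) ∧
      δ * volume.real (MASection Ω u y r) < volume.real {z ∈ MASection Ω u y r | v z ≤ N} := by
  have H := G.data
  have hθ := G.one_le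
  have hθ0 : 0 < θ := by linarith
  have he : 0 < e := by linarith [A.pos]
  have Ae : Adm Ω u y e := A.mono he (by linarith)
  have hve := hv.mono (closure_mono (section_mono (show e ≤ 2 * e by linarith)))
  have hopen : IsOpen (MASection Ω u y e ∩ v ⁻¹' Ioi N) :=
    (hve.mono subset_closure).continuousOn.isOpen_inter_preimage (Ae.isOpen H) isOpen_Ioi
  obtain ⟨s0, hs0, hsub⟩ := H.exists_section_subset Ae hopen ⟨Ae.self_mem, hy⟩
  obtain ⟨j0, hj0⟩ := exists_two_pow_ge (e / s0)
  have hgood : ∃ j : ℕ, volume.real {z ∈ MASection Ω u y (e / 2 ^ j) | v z ≤ N} ≤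
      δ * volume.real (MASection Ω u y (e / 2 ^ j)) := by
    refine ⟨j0, ?_⟩
    have hle : e / 2 ^ j0 ≤ s0 := by
      rw [div_le_iff₀ (by positivity)]
      rw [div_le_iff₀ hs0] at hj0
      linarith
    have h0 : {z ∈ MASection Ω u y (e / 2 ^ j0) | v z ≤ N} = ∅ := by
      refine eq_empty_of_forall_notMem fun z hz => ?_
      have := (hsub (section_mono hle hz.1)).2
      exact absurd hz.2 (not_le.mpr this)
    rw [h0, measureReal_empty]
    positivity
  classical
  set j := Nat.find hgood with hj
  have hjg := Nat.find_spec hgood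
  rw [← hj] at hjg
  have hj1 : j ≠ 0 := by
    intro h
    rw [h, pow_zero, div_one] at hjg
    linarith
  obtain ⟨i, hi⟩ := Nat.exists_eq_succ_of_ne_zero hj1
  have hib : ¬ volume.real {z ∈ MASection Ω u y (e / 2 ^ i) | v z ≤ N} ≤
      δ * volume.real (MASection Ω u y (e / 2 ^ i)) := Nat.find_min hgood (by omega)
  have hr0 : 0 < e / 2 ^ i := by positivity
  have hre : e / 2 ^ i ≤ e := div_le_self he.le (one_le_pow₀ one_le_two)
  have hsj : e / 2 ^ j = (e / 2 ^ i) / 2 := by rw [hi, Nat.succ_eq_add_one, pow_succ]; field_simp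
  refine ⟨e / 2 ^ i, hr0, hre, ?_, not_le.mp hib⟩
  rw [hsj] at hjg
  set r := e / 2 ^ i
  have h1 := G.large_of_density hN hδ (A.mono (half_pos hr0) (by linarith))
    (hv.mono (closure_mono (section_mono (by linarith)))) hjg
  refine G.lower_bound (half_pos hN) h1 J ?_ (A.mono (by linarith) (by linarith))
    (hv.mono (closure_mono (section_mono (by linarith))))
  calc r = 32 * θ ^ 2 * (r / 2 / (16 * θ ^ 2)) := by field_simp; norm_num
    _ ≤ 2 ^ J * (r / 2 / (16 * θ ^ 2)) := by gcongr

end Geom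

/-- The union of the sections of height `e` centered in `S(x, a)`. -/
def fatten (Ω : Set (E n)) (u : E n → ℝ) (x : E n) (a e : ℝ) : Set (E n) :=
  ⋃ y ∈ MASection Ω u x a, MASection Ω u y e

namespace Geom

variable (G : Geom Ω u lam Lam θ κ γ)
include G

lemma inner_core_subset (A : Adm Ω u x t) :
    MASection Ω u x (t / (112 * θ ^ 4)) ⊆ MASection Ω u x (t / (16 * θ ^ 2)) := by
  have ht := A.pos
  have hθ := G.one_le
  refine section_mono (div_le_div_of_nonneg_left ht.le (by positivity) ?_)
  nlinarith [one_le_pow₀ hθ (n := 2), pow_le_pow_right₀ hθ (show 2 ≤ 4 by norm_num)]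

lemma fatten_subset (A : Adm Ω u x t) {e : ℝ} (he : e ≤ t / (112 * θ ^ 4)) :
    fatten Ω u x (t / (112 * θ ^ 4)) e ⊆ MASection Ω u x (t / (16 * θ ^ 2)) := by
  have ht := A.pos
  have hθ := G.one_le
  have hθ0 : 0 < θ := by linarith
  refine iUnion₂_subset fun y hy z hz => ?_
  have h := G.mem_of_mem A (G.self_mem_core A) (G.inner_core_subset A hy)
    (s := t / (112 * θ ^ 4)) (by positivity) (by
      rw [le_div_iff₀ hθ0]
      have e1 : 6 * θ * (t / (112 * θ ^ 4)) * θ = 6 / 112 * (t / θ ^ 2) := by field_simp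
      have : t / θ ^ 2 ≤ t := div_le_self ht.le (one_le_pow₀ hθ)
      rw [e1]; linarith) hy (section_mono he hz)
  rwa [show 7 * θ ^ 2 * (t / (112 * θ ^ 4)) = t / (16 * θ ^ 2) by field_simp; norm_num] at h

lemma section_subset_fatten (A : Adm Ω u x t) {e : ℝ} (he0 : 0 < e) (he : e ≤ t / (112 * θ ^ 4))
    (hy : y ∈ fatten Ω u x (t / (112 * θ ^ 4)) e) :
    MASection Ω u y e ⊆ fatten Ω u x (t / (112 * θ ^ 4)) (7 * θ ^ 2 * e) := by
  intro w hw
  have ht := A.pos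
  have hθ := G.one_le
  have hθ0 : 0 < θ := by linarith
  have hyU := G.fatten_subset A he hy
  obtain ⟨p, hp, hyp⟩ := mem_iUnion₂.mp hy
  refine mem_biUnion hp (G.mem_of_mem A (G.inner_core_subset A hp) hyU he0 ?_ hyp hw)
  calc 6 * θ * e ≤ 6 * θ * (t / (112 * θ ^ 4)) := by gcongr
    _ = 6 / 112 * (t / θ / θ ^ 2) := by field_simp
    _ ≤ 6 / 112 * (t / θ) := by
        have : t / θ / θ ^ 2 ≤ t / θ := div_le_self (by positivity) (one_le_pow₀ hθ)
        linarith
    _ ≤ t / θ := by linarith [div_pos ht hθ0]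

lemma isOpen_fatten (A : Adm Ω u x t) {e : ℝ} (he0 : 0 < e) (he : e ≤ t / θ) :
    IsOpen (fatten Ω u x (t / (112 * θ ^ 4)) e) :=
  isOpen_biUnion fun _ hy => (G.adm A (G.inner_core_subset A hy) he0 he).isOpen G.data

/-- A supersolution which is at most one somewhere near the center is not too large on most of a
small section. -/
lemma bad_density (A : Adm Ω u x t) (hv : Super u v (closure (MASection Ω u x t)))
    (hz : z ∈ MASection Ω u x (t / (16 * θ ^ 2))) (hvz : v z ≤ 1)
    (hy : y ∈ MASection Ω u x (t / (16 * θ ^ 2))) {δ N e : ℝ} {i : ℕ} (hN : 0 < N)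
    (hδ : Lam * δ < κ * (1 / (16 * θ ^ 2)) ^ n) (he : 0 < e) (het : e ≤ t / θ)
    (hi : 4 * θ * t ≤ 2 ^ i * e) (hbig : 2 < γ ^ i * N) :
    δ * volume.real (MASection Ω u y e) < volume.real {w ∈ MASection Ω u y e | v w ≤ N} := by
  by_contra! h
  have ht := A.pos
  have hθ := G.one_le
  have hθ0 : 0 < θ := by linarith
  have hsub : ∀ {s}, s ≤ t / θ → Super u v (closure (MASection Ω u y s)) := fun hs =>
    hv.mono (closure_mono (G.section_subset A hy hs))
  have h1 := G.large_of_density hN hδ (G.adm A hy he het) (hsub het) h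
  have h2 := G.lower_bound (σ := t / (4 * θ)) (half_pos hN) h1 i (by
      rw [← mul_div_assoc, div_le_div_iff₀ (by positivity) (by positivity)]
      nlinarith)
    (G.adm A hy (by positivity) (le_of_eq (by field_simp)))
    (hsub (by rw [← mul_div_assoc, div_le_div_iff₀ (by positivity) hθ0]; nlinarith)) z ?_
  · linarith
  · have A' : Adm Ω u x (t / (8 * θ ^ 2)) :=
      A.mono (by positivity) (div_le_self ht.le (by nlinarith))
    have e1 : t / (8 * θ ^ 2) / 2 = t / (16 * θ ^ 2) := by field_simp; norm_num
    have h3 := G.engulf A' y (by rwa [e1]) z (section_mono (by rw [← e1]; linarith [A'.pos]) hz)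
    refine mem_section.mpr ⟨(mem_section.mp hz).1, h3.trans_lt ?_⟩
    rw [show θ * (t / (8 * θ ^ 2)) = t / (4 * θ) / 2 by field_simp; norm_num]
    exact half_lt_self (by positivity)

/-- One step of the decay of the distribution function of a supersolution. -/
lemma decay_step (A : Adm Ω u x t) (hv : Super u v (closure (MASection Ω u x t)))
    (hz : z ∈ MASection Ω u x (t / (16 * θ ^ 2))) (hvz : v z ≤ 1)
    {δ N N' e : ℝ} {i J : ℕ} (hJ : 32 * θ ^ 2 ≤ 2 ^ J) (hN : 0 < N) (hδ0 : 0 ≤ δ)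
    (hδ : Lam * δ < κ * (1 / (16 * θ ^ 2)) ^ n) (he : 0 < e)
    (het7 : 7 * θ ^ 2 * e ≤ t / (112 * θ ^ 4))
    (hi : 4 * θ * t ≤ 2 ^ i * e) (hbig : 2 < γ ^ i * N) (hN' : N' < γ ^ J * (N / 2)) :
    ENNReal.ofReal (δ * (1 / (70 * θ ^ 3)) ^ n) *
        volume (fatten Ω u x (t / (112 * θ ^ 4)) e ∩ v ⁻¹' Ioi N) ≤
      volume ((fatten Ω u x (t / (112 * θ ^ 4)) (7 * θ ^ 2 * e) ∩ v ⁻¹' Ioi N') \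
        (fatten Ω u x (t / (112 * θ ^ 4)) e ∩ v ⁻¹' Ioi N)) := by
  have ht := A.pos
  have hθ := G.one_le
  have hθ0 : 0 < θ := by linarith
  have het : e ≤ t / (112 * θ ^ 4) := le_trans (by nlinarith [one_le_pow₀ hθ (n := 2)]) het7
  have hθ4 : 112 * θ ^ 4 * e ≤ t := by rwa [le_div_iff₀' (by positivity)] at het
  have hθ34 : θ ^ 3 ≤ θ ^ 4 := pow_le_pow_right₀ hθ (by norm_num)
  have hθ1 : θ ≤ θ ^ 4 := le_self_pow₀ hθ (by norm_num)
  have het4 : 4 * e ≤ t / θ := by rw [le_div_iff₀ hθ0]; nlinarith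
  have het1 : e ≤ t / θ := by linarith
  have hR := G.fatten_subset A het
  have hUS : MASection Ω u x (t / (16 * θ ^ 2)) ⊆ MASection Ω u x t :=
    section_mono (div_le_self ht.le (by nlinarith))
  have hsub : ∀ {y s}, y ∈ MASection Ω u x (t / (16 * θ ^ 2)) → s ≤ t / θ →
      Super u v (closure (MASection Ω u y s)) := fun hy hs =>
    hv.mono (closure_mono (G.section_subset A hy hs))
  have key : ∀ y ∈ fatten Ω u x (t / (112 * θ ^ 4)) e ∩ v ⁻¹' Ioi N, ∃ r, 0 < r ∧ r ≤ e ∧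
      (∀ z ∈ MASection Ω u y r, γ ^ J * (N / 2) ≤ v z) ∧
      δ * volume.real (MASection Ω u y r) <
        volume.real {z ∈ MASection Ω u y r | v z ≤ N} := fun y hy =>
    G.exists_stopping hJ hδ0 hδ hN (G.adm A (hR hy.1) (by positivity) het4)
      (hsub (hR hy.1) (by linarith)) hy.2
      (G.bad_density A hv hz hvz (hR hy.1) hN hδ he het1 hi hbig)
  choose! r hr0 hre hrv hrd using key
  refine G.covering A ?_ (inter_subset_left.trans hR)
    (inter_subset_left.trans (G.fatten_subset A het7)) hr0 (fun y hy => ?_) (fun y hy w hw => ?_)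
    (fun y hy => ?_) hδ0
  · exact ((hv.continuousOn.mono ((hR.trans hUS).trans subset_closure)).isOpen_inter_preimage
      (G.isOpen_fatten A he het1) isOpen_Ioi).measurableSet
  · nlinarith [hre y hy, hr0 y hy, mul_le_mul hθ34 (hre y hy) (hr0 y hy).le (by positivity)]
  · exact ⟨G.section_subset_fatten A he het hy.1 (section_mono (hre y hy) hw),
      hN'.trans_le (hrv y hy w hw)⟩
  · have hadm : Adm Ω u y (r y) := G.adm A (hR hy.1) (hr0 y hy) ((hre y hy).trans het1)
    have hlt : volume {z ∈ MASection Ω u y (r y) | v z ≤ N} < ⊤ :=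
      (measure_mono (sep_subset _ _)).trans_lt hadm.volume_lt_top
    have hsubX : {z ∈ MASection Ω u y (r y) | v z ≤ N} ⊆ MASection Ω u y (r y) \
        (fatten Ω u x (t / (112 * θ ^ 4)) e ∩ v ⁻¹' Ioi N) := fun w hw =>
      ⟨hw.1, fun h => absurd hw.2 (not_le.mpr h.2)⟩
    refine le_trans ?_ (measure_mono hsubX)
    · rw [← ENNReal.ofReal_toReal hadm.volume_lt_top.ne, ← ENNReal.ofReal_toReal hlt.ne,
        ← ENNReal.ofReal_mul hδ0]
      exact ENNReal.ofReal_le_ofReal (hrd y hy).le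

/-- Decay of the distribution function of supersolutions. -/
theorem decay (A : Adm Ω u x t) (hv : Super u v (closure (MASection Ω u x t)))
    (hz : z ∈ MASection Ω u x (t / (16 * θ ^ 2))) (hvz : v z ≤ 1) {δ M : ℝ} {J J₁ J₂ : ℕ}
    (hJ : 32 * θ ^ 2 ≤ 2 ^ J) (hJ₁ : 448 * θ ^ 5 ≤ 2 ^ J₁) (hJ₂ : 7 * θ ^ 2 ≤ 2 ^ J₂)
    (hM : M = 3 / γ ^ (J + J₁ + J₂)) (hδ0 : 0 ≤ δ)
    (hδ : Lam * δ < κ * (1 / (16 * θ ^ 2)) ^ n) (k : ℕ) :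
    volume.real (MASection Ω u x (t / (112 * θ ^ 4)) ∩ v ⁻¹' Ioi (M ^ k)) ≤
      (1 / (1 + δ * (1 / (70 * θ ^ 3)) ^ n)) ^ k * volume.real (MASection Ω u x t) := by
  have ht := A.pos
  have hθ := G.one_le
  have hθ0 : 0 < θ := by linarith
  have hγ := G.pos
  have hγ1 := G.lt_one.le
  have hθ2 : 1 ≤ θ ^ 2 := one_le_pow₀ hθ
  set q := δ * (1 / (70 * θ ^ 3)) ^ n with hq
  have hq0 : 0 ≤ q := by positivity
  set e : ℕ → ℝ := fun k => t / (112 * θ ^ 4) / (7 * θ ^ 2) ^ k with he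
  have he0 : ∀ k, 0 < e k := fun k => by positivity
  have hes : ∀ k, 7 * θ ^ 2 * e (k + 1) = e k := fun k => by
    simp only [he, pow_succ (7 * θ ^ 2) k]; field_simp
  have hele : ∀ k, e k ≤ t / (112 * θ ^ 4) := fun k =>
    div_le_self (by positivity) (one_le_pow₀ (by linarith))
  set X : ℕ → Set (E n) := fun k => fatten Ω u x (t / (112 * θ ^ 4)) (e k) ∩ v ⁻¹' Ioi (M ^ k)
    with hX
  have hXS : ∀ k, X k ⊆ MASection Ω u x t := fun k =>
    (inter_subset_left.trans (G.fatten_subset A (hele k))).trans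
      (section_mono (div_le_self ht.le (by nlinarith)))
  have hM1 : 1 ≤ M := by
    rw [hM, le_div_iff₀ (by positivity), one_mul]
    exact (pow_le_one₀ hγ.le hγ1).trans (by norm_num)
  have hM0 : 0 < M := by linarith
  have hXX : ∀ k, X (k + 1) ⊆ X k := fun k w hw => by
    obtain ⟨p, hp, hwp⟩ := mem_iUnion₂.mp hw.1
    refine ⟨mem_biUnion hp (section_mono ?_ hwp),
      (pow_le_pow_right₀ hM1 (Nat.le_succ k)).trans_lt hw.2⟩
    nlinarith [hes k, he0 (k + 1)]
  have hXo : ∀ k, MeasurableSet (X k) := fun k =>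
    ((hv.continuousOn.mono (((G.fatten_subset A (hele k)).trans
      (section_mono (div_le_self ht.le (by nlinarith)))).trans
        subset_closure)).isOpen_inter_preimage (G.isOpen_fatten A (he0 k) ((hele k).trans (by
        refine div_le_div_of_nonneg_left ht.le hθ0 ?_
        nlinarith [le_self_pow₀ hθ (show 4 ≠ 0 by norm_num)]))) isOpen_Ioi).measurableSet
  have hXfin : ∀ k, volume (X k) ≠ ⊤ := fun k =>
    ((measure_mono (hXS k)).trans_lt A.volume_lt_top).ne
  have hγM : γ ^ (J + J₁ + J₂) * M = 3 := by rw [hM]; field_simp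
  have hstep : ∀ k, volume.real (X (k + 1)) ≤ 1 / (1 + q) * volume.real (X k) := fun k => by
    have hMk : 1 ≤ M ^ k := one_le_pow₀ hM1
    have h := G.decay_step A hv hz hvz (δ := δ) (N := M ^ (k + 1)) (N' := M ^ k) (e := e (k + 1))
      (i := J₁ + J₂ * (k + 1)) hJ (by positivity) hδ0 hδ (he0 _)
      (by rw [hes]; exact hele k) ?_ ?_ ?_
    · rw [hes] at h
      change ENNReal.ofReal q * volume (X (k + 1)) ≤ volume (X k \ X (k + 1)) at h
      have h2 := ENNReal.toReal_mono
        ((measure_mono sdiff_subset).trans_lt (hXfin k).lt_top).ne h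
      rw [ENNReal.toReal_mul, ENNReal.toReal_ofReal hq0] at h2
      change q * volume.real (X (k + 1)) ≤ volume.real (X k \ X (k + 1)) at h2
      rw [measureReal_sdiff (hXX k) (hXo _) (hXfin _)] at h2
      rw [one_div, inv_mul_eq_div, le_div_iff₀ (by positivity)]
      linarith
    · calc 4 * θ * t = 448 * θ ^ 5 * (7 * θ ^ 2) ^ (k + 1) * e (k + 1) := by
            simp only [he]; field_simp; norm_num
        _ ≤ 2 ^ J₁ * (2 ^ J₂) ^ (k + 1) * e (k + 1) := by
            gcongr
        _ = _ := by rw [pow_add 2 J₁, pow_mul 2 J₂]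
    · have h1 : γ ^ ((J + J₁ + J₂) * (k + 1)) ≤ γ ^ (J₁ + J₂ * (k + 1)) :=
        pow_le_pow_of_le_one hγ.le hγ1 (by nlinarith)
      calc (2 : ℝ) < 3 := by norm_num
        _ ≤ 3 ^ (k + 1) := le_self_pow₀ (by norm_num) (by omega)
        _ = γ ^ ((J + J₁ + J₂) * (k + 1)) * M ^ (k + 1) := by rw [pow_mul, ← mul_pow, hγM]
        _ ≤ _ := by gcongr
    · have h1 : γ ^ (J + J₁ + J₂) ≤ γ ^ J := pow_le_pow_of_le_one hγ.le hγ1 (by omega)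
      calc M ^ k < 3 / 2 * M ^ k := by linarith
        _ = γ ^ (J + J₁ + J₂) * (M ^ (k + 1) / 2) := by rw [pow_succ, ← hγM]; ring
        _ ≤ _ := by gcongr
  have hall : ∀ k, volume.real (X k) ≤ (1 / (1 + q)) ^ k * volume.real (MASection Ω u x t) := by
    intro k
    induction k with
    | zero => simpa using measureReal_mono (hXS 0) A.volume_lt_top.ne
    | succ k ih =>
      calc volume.real (X (k + 1)) ≤ 1 / (1 + q) * volume.real (X k) := hstep k
        _ ≤ 1 / (1 + q) * ((1 / (1 + q)) ^ k * volume.real (MASection Ω u x t)) := by gcongr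
        _ = _ := by ring
  have hsub : MASection Ω u x (t / (112 * θ ^ 4)) ∩ v ⁻¹' Ioi (M ^ k) ⊆ X k := fun w hw =>
    ⟨mem_biUnion hw.1 (G.adm A (G.inner_core_subset A hw.1) (he0 k) ((hele k).trans (by
      refine div_le_div_of_nonneg_left ht.le hθ0 ?_
      nlinarith [le_self_pow₀ hθ (show 4 ≠ 0 by norm_num)]))).self_mem, hw.2⟩
  exact (measureReal_mono hsub (hXfin k)).trans (hall k)

end Geom

namespace Geom

variable (G : Geom Ω u lam Lam θ κ γ)
include G

/-- If a solution is large at the center of a section and not large on most of it, then it is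
even larger somewhere in the section. -/
lemma exists_larger (A : Adm Ω u y r) (hv : Super u v (closure (MASection Ω u y r)))
    (hL : ∀ w ∈ closure (MASection Ω u y r), Lop u v w = 0) {N F : ℝ} (hN : 0 < N) (hF : 1 < F)
    (hy : N < v y)
    (hsmall : Lam * volume.real (MASection Ω u y r ∩ v ⁻¹' Ioi (N / 4)) <
      κ * (1 / (4 * (2 * F - 1))) ^ n * volume.real (MASection Ω u y r)) :
    ∃ z ∈ closure (MASection Ω u y r), F * N < v z := by
  by_contra! h
  have hF1 : 0 < F - 1 := by linarith
  have hF2 : 0 < 2 * F - 1 := by linarith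
  have hw : Super u (fun z => F * N + -1 * v z) (closure (MASection Ω u y r)) := fun z hz => by
    have h1 := (hv z hz).1
    refine ⟨contDiffAt_const.add (contDiffAt_const.mul h1), by linarith [h z hz], ?_⟩
    rw [Lop_add contDiffAt_const (contDiffAt_const.mul h1), Lop_const, Lop_const_mul h1, hL z hz]
    simp
  have h1 := Super.density G.dim G.data G.slope A hw (a := (F - 1) * N)
    (β := 1 / (2 * (F - 1))) (by positivity) (by positivity) (by linarith)
  rw [show 1 / (2 * (F - 1)) / (4 * (1 + 1 / (2 * (F - 1)))) = 1 / (4 * (2 * F - 1)) by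
    have : 1 + 1 / (2 * (F - 1)) = (2 * F - 1) / (2 * (F - 1)) := by field_simp; ring
    rw [this]; field_simp] at h1
  have h2 : (1 + 1 / (2 * (F - 1))) * ((F - 1) * N) = F * N - N / 2 := by field_simp; ring
  rw [h2] at h1
  have h3 : volume.real {z ∈ MASection Ω u y r | F * N + -1 * v z ≤ F * N - N / 2} ≤
      volume.real (MASection Ω u y r ∩ v ⁻¹' Ioi (N / 4)) :=
    measureReal_mono (fun z hz => ⟨hz.1, by
      have := hz.2
      simp only [mem_preimage, mem_Ioi]
      linarith⟩) ((measure_mono inter_subset_left).trans_lt A.volume_lt_top).ne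
  have := mul_le_mul_of_nonneg_left h3 (G.data.Lam_pos A.mem).le
  linarith

/-- The inductive step of the blow-up argument for solutions with decaying distribution
function. -/
lemma exists_larger_of_decay (A : Adm Ω u x t) (hv : Super u v (closure (MASection Ω u x t)))
    (hL : ∀ w ∈ closure (MASection Ω u x t), Lop u v w = 0) {N F D : ℝ} (hN : 0 < N) (hF : 1 < F)
    (hy : y ∈ MASection Ω u x (t / (112 * θ ^ 4))) (hr : 0 < r) (hrt : 12 * θ * r ≤ t / θ)
    (hsub : MASection Ω u y (14 * θ ^ 2 * r) ⊆ MASection Ω u x (t / (112 * θ ^ 4)))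
    (hdec : volume.real (MASection Ω u x (t / (112 * θ ^ 4)) ∩ v ⁻¹' Ioi (N / 4)) ≤
      D * volume.real (MASection Ω u x t))
    (hD : Lam * D < κ * (1 / (4 * (2 * F - 1))) ^ n * (r / (2 * (θ * t))) ^ n) (hNy : N < v y) :
    ∃ z ∈ MASection Ω u x (t / (112 * θ ^ 4)),
      MASection Ω u z (2 * r) ⊆ MASection Ω u x (t / (112 * θ ^ 4)) ∧ F * N < v z := by
  have ht := A.pos
  have hθ := G.one_le
  have hθ0 : 0 < θ := by linarith
  have hκ := G.slope_pos
  have hF2 : 0 < 2 * F - 1 := by linarith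
  have hθ2 : 1 ≤ θ ^ 2 := one_le_pow₀ hθ
  have hcU := G.inner_core_subset A
  have hrt2 : 2 * r ≤ t / θ := by nlinarith
  have A2 : Adm Ω u y (2 * r) := G.adm A (hcU hy) (by positivity) hrt2
  have A1 : Adm Ω u y r := A2.mono hr (by linarith)
  have hsub2 : MASection Ω u y (2 * r) ⊆ MASection Ω u x (t / (112 * θ ^ 4)) :=
    (section_mono (by nlinarith)).trans hsub
  have hsub1 : MASection Ω u y r ⊆ MASection Ω u x (t / (112 * θ ^ 4)) :=
    (section_mono (by linarith)).trans hsub2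
  have hcl : closure (MASection Ω u y r) ⊆ closure (MASection Ω u x t) :=
    closure_mono (G.section_subset A (hcU hy) (by linarith))
  have hct : MASection Ω u x (t / (112 * θ ^ 4)) ⊆ MASection Ω u x t :=
    section_mono (div_le_self ht.le (by linarith [one_le_pow₀ hθ (n := 4)]))
  have hLam := G.data.Lam_pos A.mem
  have hsmall : Lam * volume.real (MASection Ω u y r ∩ v ⁻¹' Ioi (N / 4)) <
      κ * (1 / (4 * (2 * F - 1))) ^ n * volume.real (MASection Ω u y r) := by
    have h1 : volume.real (MASection Ω u y r ∩ v ⁻¹' Ioi (N / 4)) ≤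
        D * volume.real (MASection Ω u x t) :=
      (measureReal_mono (inter_subset_inter_left _ hsub1)
        ((measure_mono (inter_subset_left.trans hct)).trans_lt A.volume_lt_top).ne).trans hdec
    have h2 := G.data.le_volume_real_section A1 (B := MASection Ω u x t) (m := θ * t)
      (A.subset.trans subset_closure) (fun w hw => G.engulf A y (section_mono
        (div_le_div_of_nonneg_left ht.le two_pos (by linarith)) (hcU hy)) w hw) (by
          rw [le_div_iff₀ hθ0] at hrt2
          nlinarith)
    calc Lam * volume.real (MASection Ω u y r ∩ v ⁻¹' Ioi (N / 4))
        ≤ Lam * (D * volume.real (MASection Ω u x t)) := by gcongr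
      _ = Lam * D * volume.real (MASection Ω u x t) := by ring
      _ < κ * (1 / (4 * (2 * F - 1))) ^ n * (r / (2 * (θ * t))) ^ n *
            volume.real (MASection Ω u x t) := mul_lt_mul_of_pos_right hD (A.volume_real_pos G.data)
      _ = κ * (1 / (4 * (2 * F - 1))) ^ n *
            ((r / (2 * (θ * t))) ^ n * volume.real (MASection Ω u x t)) := by ring
      _ ≤ _ := mul_le_mul_of_nonneg_left h2 (by positivity)
  obtain ⟨z, hz, hNz⟩ := G.exists_larger A1 (hv.mono hcl) (fun w hw => hL w (hcl hw))
    hN hF hNy hsmall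
  have hz2 : z ∈ MASection Ω u y (2 * r) := A2.closure_subset_of_lt G.data (by linarith) hr hz
  have hzc := hsub2 hz2
  refine ⟨z, hzc, fun w hw => hsub ?_, hNz⟩
  have := G.mem_of_mem A (hcU hy) (hcU hzc) (by positivity) (by linarith) hz2 hw
  rwa [show 7 * θ ^ 2 * (2 * r) = 14 * θ ^ 2 * r by ring] at this

end Geom

theorem exists_sup_const (hθ : 1 ≤ θ) (hκ : 0 < κ) (hγ : 0 < γ) (hγ1 : γ < 1) (hL : 0 < Lam) :
    ∃ C > 0, ∀ {Ω : Set (E n)} {u : E n → ℝ} {lam : ℝ}, Geom Ω u lam Lam θ κ γ →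
      ∀ {x : E n} {t : ℝ}, Adm Ω u x t → ∀ {v : E n → ℝ},
      Super u v (closure (MASection Ω u x t)) →
      (∀ w ∈ closure (MASection Ω u x t), Lop u v w = 0) →
      ∀ y ∈ MASection Ω u x (t / (784 * θ ^ 6)), ∀ z ∈ MASection Ω u x (t / (784 * θ ^ 6)),
        v z ≤ 1 → v y ≤ C := by
  have hθ0 : 0 < θ := by linarith
  obtain ⟨J, hJ⟩ := Geom.exists_two_pow_ge (32 * θ ^ 2)
  obtain ⟨J₁, hJ₁⟩ := Geom.exists_two_pow_ge (448 * θ ^ 5)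
  obtain ⟨J₂, hJ₂⟩ := Geom.exists_two_pow_ge (7 * θ ^ 2)
  set M : ℝ := 3 / γ ^ (J + J₁ + J₂) with hM
  have hM1 : 1 < M := by
    rw [hM, lt_div_iff₀ (by positivity), one_mul]
    exact (pow_le_one₀ hγ.le hγ1.le).trans_lt (by norm_num)
  have hM0 : 0 < M := by linarith
  set δ : ℝ := κ / (2 * Lam) * (1 / (16 * θ ^ 2)) ^ n with hδ
  have hδ0 : 0 < δ := by positivity
  have hδ1 : Lam * δ < κ * (1 / (16 * θ ^ 2)) ^ n := by
    have e : Lam * δ = κ * (1 / (16 * θ ^ 2)) ^ n / 2 := by rw [hδ]; field_simp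
    rw [e]
    exact half_lt_self (by positivity)
  set ρ : ℝ := 1 / (1 + δ * (1 / (70 * θ ^ 3)) ^ n) with hρ
  have hq : 0 < δ * (1 / (70 * θ ^ 3)) ^ n := by positivity
  have hρ0 : 0 < ρ := by positivity
  have hρ1 : ρ < 1 := by rw [hρ, div_lt_one (by positivity)]; linarith
  set μ : ℝ := 1 / (7 * θ ^ 2) with hμ
  have hμ0 : 0 < μ := by positivity
  have hθ2 : 1 ≤ θ ^ 2 := one_le_pow₀ hθ
  have hμ1 : μ ≤ 1 := by rw [hμ, div_le_one (by positivity)]; linarith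
  obtain ⟨l, hl⟩ := exists_pow_lt_of_lt_one (show 0 < μ ^ n by positivity) hρ1
  have hl0 : l ≠ 0 := by
    rintro rfl
    exact absurd (hl.trans_le (pow_le_one₀ hμ0.le hμ1)) (by simp)
  set F : ℝ := M ^ l with hF
  have hF1 : 1 < F := one_lt_pow₀ hM1 hl0
  have hF2 : 0 < 2 * F - 1 := by linarith
  set R : ℝ := 1 / (10976 * θ ^ 8) with hR
  obtain ⟨k₀, hk₀⟩ := exists_pow_lt_of_lt_one
    (show 0 < κ * (1 / (4 * (2 * F - 1))) ^ n * (R / (2 * θ)) ^ n / Lam by positivity) hρ1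
  rw [lt_div_iff₀ hL] at hk₀
  refine ⟨4 * M ^ k₀, by positivity, fun {Ω u lam} G {x t} A {v} hv hLv y hy z hz hvz => ?_⟩
  have ht := A.pos
  set a : ℝ := t / (112 * θ ^ 4) with ha
  set r : ℕ → ℝ := fun j => t * R * μ ^ j with hr
  set N : ℕ → ℝ := fun j => 4 * M ^ (k₀ + l * j) with hN
  have hr0 : ∀ j, 0 < r j := fun j => by positivity
  have hN0 : ∀ j, 0 < N j := fun j => by positivity
  have hrs : ∀ j, 7 * θ ^ 2 * r (j + 1) = r j := fun j => by
    simp only [hr, hμ, pow_succ (1 / (7 * θ ^ 2)) j]; field_simp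
  have hNs : ∀ j, F * N j = N (j + 1) := fun j => by
    simp only [hN, hF]; ring
  have h16 : θ ^ 2 ≤ θ ^ 8 := pow_le_pow_right₀ hθ (by norm_num)
  have hrt : ∀ j, 12 * θ * r j ≤ t / θ := fun j => by
    rw [le_div_iff₀ hθ0]
    have h1 : r j ≤ t * R := mul_le_of_le_one_right (by positivity) (pow_le_one₀ hμ0.le hμ1)
    have h2 : t * R * (10976 * θ ^ 8) = t := by rw [hR]; field_simp
    nlinarith [hr0 j, mul_le_mul h16 h1 (hr0 j).le (by positivity)]
  have hz' : z ∈ MASection Ω u x (t / (16 * θ ^ 2)) := section_mono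
    (div_le_div_of_nonneg_left ht.le (by positivity) (by
      linarith [pow_le_pow_right₀ hθ (show 2 ≤ 6 by norm_num)])) hz
  have hdec := G.decay A hv hz' hvz hJ hJ₁ hJ₂ hM hδ0.le hδ1
  rw [← hρ] at hdec
  have hstep : ∀ j, ∀ y ∈ MASection Ω u x a, MASection Ω u y (14 * θ ^ 2 * r j) ⊆
      MASection Ω u x a → N j < v y → ∃ z ∈ MASection Ω u x a,
      MASection Ω u z (14 * θ ^ 2 * r (j + 1)) ⊆ MASection Ω u x a ∧ N (j + 1) < v z := by
    intro j y hy hsub hNy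
    rw [show 14 * θ ^ 2 * r (j + 1) = 2 * r j by rw [← hrs j]; ring, ← hNs]
    refine G.exists_larger_of_decay A hv hLv (hN0 j) hF1 hy (hr0 j) (hrt j) hsub
      (D := ρ ^ (k₀ + l * j)) ?_ ?_ hNy
    · rw [show N j / 4 = M ^ (k₀ + l * j) by simp only [hN]; ring]
      exact hdec (k₀ + l * j)
    · have h3 : r j / (2 * (θ * t)) = R / (2 * θ) * μ ^ j := by
        simp only [hr]; field_simp
      have h4 : (ρ ^ l) ^ j ≤ (μ ^ n) ^ j := pow_le_pow_left₀ (by positivity) hl.le j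
      rw [h3, mul_pow, ← pow_mul, mul_comm j n, pow_mul]
      calc Lam * ρ ^ (k₀ + l * j) = (ρ ^ k₀ * Lam) * (ρ ^ l) ^ j := by
            rw [pow_add, pow_mul]; ring
        _ ≤ (ρ ^ k₀ * Lam) * (μ ^ n) ^ j := mul_le_mul_of_nonneg_left h4 (by positivity)
        _ < κ * (1 / (4 * (2 * F - 1))) ^ n * (R / (2 * θ)) ^ n * (μ ^ n) ^ j :=
            mul_lt_mul_of_pos_right hk₀ (by positivity)
        _ = _ := by ring
  obtain ⟨B, hB⟩ := (A.cpt.1.image_of_continuousOn hv.continuousOn).bddAbove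
  by_contra! hC
  have hya : y ∈ MASection Ω u x a := section_mono (by
    refine div_le_div_of_nonneg_left ht.le (by positivity) ?_
    linarith [pow_le_pow_right₀ hθ (show 4 ≤ 6 by norm_num), one_le_pow₀ hθ (n := 6)]) hy
  have hall : ∀ j, ∃ y ∈ MASection Ω u x a,
      MASection Ω u y (14 * θ ^ 2 * r j) ⊆ MASection Ω u x a ∧ N j < v y := by
    intro j
    induction j with
    | zero =>
      refine ⟨y, hya, fun w hw => ?_, by simpa [hN] using hC⟩
      rw [show 14 * θ ^ 2 * r 0 = t / (784 * θ ^ 6) by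
        simp only [hr, hR]; field_simp; norm_num] at hw
      have := G.mem_of_mem A (G.self_mem_core A) (G.inner_core_subset A hya) (by positivity) (by
        rw [le_div_iff₀ hθ0, show 6 * θ * (t / (784 * θ ^ 6)) * θ = 6 * (t / (784 * θ ^ 4)) by
          field_simp]
        have h1 : t / (784 * θ ^ 4) ≤ t / 784 :=
          div_le_div_of_nonneg_left ht.le (by norm_num) (by linarith [one_le_pow₀ hθ (n := 4)])
        linarith) hy hw
      rwa [show 7 * θ ^ 2 * (t / (784 * θ ^ 6)) = a by
        rw [ha]; field_simp; norm_num] at this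
    | succ j ih =>
      obtain ⟨y, h1, h2, h3⟩ := ih
      exact hstep j y h1 h2 h3
  obtain ⟨j, hj⟩ := pow_unbounded_of_one_lt B hF1
  obtain ⟨p, hp, -, hNp⟩ := hall j
  have h1 : v p ≤ B := hB ⟨p, subset_closure (section_mono
    (div_le_self ht.le (by linarith [one_le_pow₀ hθ (n := 4)])) hp), rfl⟩
  have h2 : F ^ j ≤ N j := by
    simp only [hN, hF]
    rw [pow_add, ← pow_mul, ← mul_assoc]
    exact le_mul_of_one_le_left (by positivity) (by linarith [one_le_pow₀ hM1.le (n := k₀)])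
  linarith

end LinMA

namespace LinMA

open Set Filter Topology

variable {n : ℕ}

variable {lam Lam : ℝ}

/-- The Harnack inequality for positive solutions on sections in a local setting. -/
theorem exists_harnack_const (hn : 0 < n) (hl : 0 < lam) (hlL : lam ≤ Lam) :
    ∃ τ > 0, τ < 1 ∧ ∃ C > 0, ∀ {Ω : Set (E n)} {u : E n → ℝ}, MAData Ω u lam Lam →
      ∀ {x : E n} {t : ℝ}, Adm Ω u x t → ∀ {v : E n → ℝ},
      (∀ w ∈ MASection Ω u x t, ContDiffAt ℝ 2 v w ∧ 0 ≤ v w ∧ Lop u v w = 0) →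
      ∀ y ∈ MASection Ω u x (τ * t), ∀ z ∈ MASection Ω u x (τ * t), v y ≤ C * v z := by
  obtain ⟨θ, κ, γ, hθ, hκ, hγ, hγ1, hG⟩ := exists_geom_const hn hl hlL
  obtain ⟨C, hC, hsup⟩ := exists_sup_const (n := n) hθ hκ hγ hγ1 (hl.trans_le hlL)
  have hθ6 : 1 ≤ θ ^ 6 := one_le_pow₀ hθ
  refine ⟨1 / (2 * (784 * θ ^ 6)), by positivity, ?_, C, hC,
    fun {Ω u} H {x t} A {v} hv y hy z hz => ?_⟩
  · rw [div_lt_one (by positivity)]; linarith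
  have ht := A.pos
  have hcl := A.closure_subset_of_lt H (half_lt_self ht) (half_pos ht)
  have A' := A.mono (half_pos ht) (half_le_self ht.le)
  have e : 1 / (2 * (784 * θ ^ 6)) * t = t / 2 / (784 * θ ^ 6) := by field_simp
  rw [e] at hy hz
  have hzS : z ∈ MASection Ω u x t := section_mono (by
    rw [← e]
    refine mul_le_of_le_one_left ht.le ?_
    rw [div_le_one (by positivity)]; linarith) hz
  have hvz := (hv z hzS).2.1
  refine le_of_forall_pos_le_add fun ε hε => ?_
  have hp : 0 < v z + ε / C := by positivity
  have h := hsup (hG H) A' (v := fun w => (v z + ε / C)⁻¹ * v w)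
    (Super.const_mul (fun w hw => ⟨(hv w (hcl hw)).1, (hv w (hcl hw)).2.1,
      (hv w (hcl hw)).2.2.le⟩) (inv_pos.mpr hp).le)
    (fun w hw => by rw [Lop_const_mul (hv w (hcl hw)).1, (hv w (hcl hw)).2.2, mul_zero])
    y hy z hz (by
      rw [inv_mul_eq_div, div_le_one hp]
      linarith [div_pos hε hC])
  rw [inv_mul_eq_div, div_le_iff₀ hp, mul_add, mul_div_cancel₀ _ hC.ne'] at h
  exact h

end LinMA

/-- Theorem 2.2: Caffarelli–Gutiérrez Harnack inequality for the linearized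
Monge-Ampère equation. -/
theorem caffarelli_gutierrez_harnack (n : ℕ) (hn : 2 ≤ n)
    (lam Lam : ℝ) (hlam : 0 < lam) (hlL : lam ≤ Lam) :
    ∃ τ : ℝ, 0 < τ ∧ τ < 1 ∧ ∃ C > 0, ∀ (Ω : Set (E n)) (u : E n → ℝ),
      MASetup Ω u → DetBounds Ω u lam Lam →
      ∀ x ∈ Ω, ∀ t : ℝ, 0 < t → CptIn (MASection Ω u x t) Ω →
      ∀ v : E n → ℝ, ContDiffOn ℝ 2 v (MASection Ω u x t) →
        (∀ y ∈ MASection Ω u x t, 0 ≤ v y) →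
        (∀ y ∈ MASection Ω u x t, ∑ i, ∑ j, cofU u y i j * pd2 v y i j = 0) →
        ∀ y ∈ MASection Ω u x (τ * t), ∀ z ∈ MASection Ω u x (τ * t), v y ≤ C * v z := by
  obtain ⟨τ, hτ, hτ1, C, hC, h⟩ := LinMA.exists_harnack_const (n := n) (by omega) hlam hlL
  refine ⟨τ, hτ, hτ1, C, hC, fun Ω u hu hd x hx t ht hS v hv hv0 hLv => ?_⟩
  have H := LinMA.MAData.of_setup hu hd hlam
  have A : LinMA.Adm Ω u x t := ⟨hx, ht, hS⟩
  exact h H A fun w hw =>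
    ⟨hv.contDiffAt ((A.isOpen H).mem_nhds hw), hv0 w hw, hLv w hw⟩
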